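/- arXiv:2605.24329 — 10 statements merged into one kernel-verified Lean document; each statement's English description precedes it below -/
import Mathlib

section
/- Let d ≥ 1, let x₀, x₁ ∈ ℝ^d and r₀, r₁ > 0 with 0 < ‖x₀ − x₁‖ < π/2, and set z₀ = (x₀, r₀), z₁ = (x₁, r₁). Then the interpolating curve Z(s) = (X(s), R(s)) given by the cone geodesic interpolation formulas is a constant-speed geodesic for the cone distance: for all s, t ∈ [0,1], d_C(Z(s), Z(t)) = |t − s| · d_C(z₀, z₁). -/
open Real

noncomputable section

/-- The cone distance on `ℝ^d × ℝ` (radial coordinates in the second factor):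
`d_C((x₀,r₀),(x₁,r₁))² = r₀² + r₁² − 2 r₀ r₁ cos(min(‖x₀ − x₁‖, π))`. -/
def coneDist {d : ℕ} (z₀ z₁ : EuclideanSpace ℝ (Fin d) × ℝ) : ℝ :=
  Real.sqrt (z₀.2 ^ 2 + z₁.2 ^ 2 -
    2 * z₀.2 * z₁.2 * Real.cos (min ‖z₀.1 - z₁.1‖ π))

/-- Radial component of the cone geodesic interpolation. -/
def coneGeoR {d : ℕ} (x₀ x₁ : EuclideanSpace ℝ (Fin d)) (r₀ r₁ s : ℝ) : ℝ :=
  Real.sqrt ((1 - s) ^ 2 * r₀ ^ 2 + s ^ 2 * r₁ ^ 2 +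
    2 * s * (1 - s) * r₀ * r₁ * Real.cos ‖x₀ - x₁‖)

/-- Interpolation parameter of the spatial component of the cone geodesic. -/
def coneGeoRho {d : ℕ} (x₀ x₁ : EuclideanSpace ℝ (Fin d)) (r₀ r₁ s : ℝ) : ℝ :=
  Real.arccos (((1 - s) * r₀ + s * r₁ * Real.cos ‖x₀ - x₁‖) /
      coneGeoR x₀ x₁ r₀ r₁ s) / ‖x₀ - x₁‖

/-- Spatial component of the cone geodesic interpolation. -/
def coneGeoX {d : ℕ} (x₀ x₁ : EuclideanSpace ℝ (Fin d)) (r₀ r₁ s : ℝ) :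
    EuclideanSpace ℝ (Fin d) :=
  (1 - coneGeoRho x₀ x₁ r₀ r₁ s) • x₀ + coneGeoRho x₀ x₁ r₀ r₁ s • x₁

/-- The cone geodesic interpolation `Z(s) = (X(s), R(s))`. -/
def coneGeoZ {d : ℕ} (x₀ x₁ : EuclideanSpace ℝ (Fin d)) (r₀ r₁ s : ℝ) :
    EuclideanSpace ℝ (Fin d) × ℝ :=
  (coneGeoX x₀ x₁ r₀ r₁ s, coneGeoR x₀ x₁ r₀ r₁ s)

/-- For `B ≥ 0`, the angle `arccos (A / R)` with `R = √(A² + B²)` is the argument of `(A, B)`. -/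
theorem mul_cos_sub_arccos_div {A B A' B' R R' : ℝ} (hB : 0 ≤ B) (hB' : 0 ≤ B')
    (hR : 0 < R) (hR' : 0 < R') (h : R ^ 2 = A ^ 2 + B ^ 2) (h' : R' ^ 2 = A' ^ 2 + B' ^ 2) :
    R * R' * cos (arccos (A / R) - arccos (A' / R')) = A * A' + B * B' := by
  have key : ∀ {A B R : ℝ}, 0 ≤ B → 0 < R → R ^ 2 = A ^ 2 + B ^ 2 →
      R * cos (arccos (A / R)) = A ∧ R * sin (arccos (A / R)) = B := by
    intro A B R hB hR h
    have hA : |A| ≤ R := abs_le_of_sq_le_sq (by nlinarith [sq_nonneg B]) hR.le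
    rw [abs_le] at hA
    rw [cos_arccos ((le_div_iff₀ hR).2 (by linarith)) ((div_le_one hR).2 hA.2), sin_arccos]
    have hsq : 1 - (A / R) ^ 2 = (B / R) ^ 2 := by
      field_simp
      linarith
    rw [hsq, sqrt_sq (div_nonneg hB hR.le)]
    exact ⟨mul_div_cancel₀ A hR.ne', mul_div_cancel₀ B hR.ne'⟩
  obtain ⟨hc, hs⟩ := key hB hR h
  obtain ⟨hc', hs'⟩ := key hB' hR' h'
  rw [cos_sub]
  linear_combination hc * (R' * cos (arccos (A' / R'))) + A * hc' +
    hs * (R' * sin (arccos (A' / R'))) + B * hs'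

theorem norm_coneGeoX_sub {d : ℕ} {x₀ x₁ : EuclideanSpace ℝ (Fin d)} (hx : 0 < ‖x₀ - x₁‖)
    (r₀ r₁ s t : ℝ) :
    ‖coneGeoX x₀ x₁ r₀ r₁ s - coneGeoX x₀ x₁ r₀ r₁ t‖ =
      |arccos (((1 - s) * r₀ + s * r₁ * cos ‖x₀ - x₁‖) / coneGeoR x₀ x₁ r₀ r₁ s) -
        arccos (((1 - t) * r₀ + t * r₁ * cos ‖x₀ - x₁‖) / coneGeoR x₀ x₁ r₀ r₁ t)| := by
  have h : coneGeoX x₀ x₁ r₀ r₁ s - coneGeoX x₀ x₁ r₀ r₁ t =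
      (coneGeoRho x₀ x₁ r₀ r₁ t - coneGeoRho x₀ x₁ r₀ r₁ s) • (x₀ - x₁) := by
    unfold coneGeoX
    module
  rw [h, norm_smul, Real.norm_eq_abs, abs_sub_comm]
  unfold coneGeoRho
  rw [← sub_div, abs_div, abs_of_pos hx, div_mul_cancel₀ _ hx.ne']

theorem coneGeoR_pos_and_sq {d : ℕ} {x₀ x₁ : EuclideanSpace ℝ (Fin d)} {r₀ r₁ s : ℝ}
    (hr₀ : 0 < r₀) (hr₁ : 0 < r₁) (hc : 0 < cos ‖x₀ - x₁‖) (hs : s ∈ Set.Icc (0 : ℝ) 1) :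
    0 < coneGeoR x₀ x₁ r₀ r₁ s ∧
      coneGeoR x₀ x₁ r₀ r₁ s ^ 2 = ((1 - s) * r₀ + s * r₁ * cos ‖x₀ - x₁‖) ^ 2 +
        (s * r₁ * sin ‖x₀ - x₁‖) ^ 2 := by
  have hA : 0 < (1 - s) * r₀ + s * r₁ * cos ‖x₀ - x₁‖ := by
    rcases hs.1.eq_or_lt with rfl | h0
    · simpa using hr₀
    · have h1 := mul_nonneg (sub_nonneg.2 hs.2) hr₀.le
      positivity
  have hR : (1 - s) ^ 2 * r₀ ^ 2 + s ^ 2 * r₁ ^ 2 + 2 * s * (1 - s) * r₀ * r₁ * cos ‖x₀ - x₁‖ =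
      ((1 - s) * r₀ + s * r₁ * cos ‖x₀ - x₁‖) ^ 2 + (s * r₁ * sin ‖x₀ - x₁‖) ^ 2 := by
    linear_combination -(s ^ 2 * r₁ ^ 2) * sin_sq_add_cos_sq ‖x₀ - x₁‖
  unfold coneGeoR
  rw [hR]
  exact ⟨sqrt_pos.2 (by positivity), sq_sqrt (by positivity)⟩

/-- The cone geodesic interpolation is a constant-speed geodesic for the cone distance:
for all `s, t ∈ [0,1]`, `d_C(Z(s), Z(t)) = |t − s| ⬝ d_C(z₀, z₁)`. -/
theorem cone_geodesic_constant_speed {d : ℕ} (hd : 1 ≤ d)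
    (x₀ x₁ : EuclideanSpace ℝ (Fin d)) (r₀ r₁ : ℝ)
    (hr₀ : 0 < r₀) (hr₁ : 0 < r₁)
    (hx : 0 < ‖x₀ - x₁‖) (hx' : ‖x₀ - x₁‖ < π / 2) :
    ∀ s ∈ Set.Icc (0 : ℝ) 1, ∀ t ∈ Set.Icc (0 : ℝ) 1,
      coneDist (coneGeoZ x₀ x₁ r₀ r₁ s) (coneGeoZ x₀ x₁ r₀ r₁ t) =
        |t - s| * coneDist (x₀, r₀) (x₁, r₁) := by
  intro s hs t ht
  have hc : 0 < cos ‖x₀ - x₁‖ := cos_pos_of_mem_Ioo ⟨by linarith, hx'⟩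
  have hsin : 0 < sin ‖x₀ - x₁‖ := sin_pos_of_pos_of_lt_pi hx (by linarith)
  obtain ⟨hRs, hRs2⟩ := coneGeoR_pos_and_sq (x₀ := x₀) (x₁ := x₁) hr₀ hr₁ hc hs
  obtain ⟨hRt, hRt2⟩ := coneGeoR_pos_and_sq (x₀ := x₀) (x₁ := x₁) hr₀ hr₁ hc ht
  have hBs : 0 ≤ s * r₁ * sin ‖x₀ - x₁‖ := mul_nonneg (mul_nonneg hs.1 hr₁.le) hsin.le
  have hBt : 0 ≤ t * r₁ * sin ‖x₀ - x₁‖ := mul_nonneg (mul_nonneg ht.1 hr₁.le) hsin.le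
  have hangle := mul_cos_sub_arccos_div hBs hBt hRs hRt hRs2 hRt2
  have hpi : ∀ a b : ℝ, |arccos a - arccos b| ≤ π := fun a b =>
    abs_sub_le_iff.2 ⟨by linarith [arccos_le_pi a, arccos_nonneg b],
      by linarith [arccos_le_pi b, arccos_nonneg a]⟩
  unfold coneDist coneGeoZ
  dsimp only
  rw [norm_coneGeoX_sub hx, min_eq_left (hpi _ _), cos_abs, min_eq_left (by linarith),
    ← sqrt_sq_eq_abs, ← sqrt_mul (sq_nonneg _)]
  congr 1
  linear_combination hRs2 + hRt2 - 2 * hangle +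
    (t - s) ^ 2 * r₁ ^ 2 * sin_sq_add_cos_sq ‖x₀ - x₁‖

end
end

section
/- Let x₀, x₁ ∈ ℝ^d and r₀, r₁ > 0 with θ := ‖x₁ − x₀‖ ∈ (0, π). With X(s), R(s) the cone geodesic interpolation formulas between (x₀,r₀) and (x₁,r₁), the one-sided derivatives at s = 0 exist and equal lim_{s→0⁺} (X(s) − x₀)/s = (sin θ · r₁ / (θ r₀)) · (x₁ − x₀) and lim_{s→0⁺} (R(s) − r₀)/s = r₁ cos θ − r₀. -/
open Real Filter

noncomputable section

theorem coneGeoR_zero {d : ℕ} (x₀ x₁ : EuclideanSpace ℝ (Fin d)) {r₀ : ℝ} (r₁ : ℝ)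
    (hr₀ : 0 ≤ r₀) : coneGeoR x₀ x₁ r₀ r₁ 0 = r₀ := by
  simp [coneGeoR, Real.sqrt_sq hr₀]

theorem hasDerivAt_coneGeoR_zero {d : ℕ} (x₀ x₁ : EuclideanSpace ℝ (Fin d)) {r₀ : ℝ} (r₁ : ℝ)
    (hr₀ : 0 < r₀) :
    HasDerivAt (coneGeoR x₀ x₁ r₀ r₁) (r₁ * Real.cos ‖x₀ - x₁‖ - r₀) 0 := by
  have hs := hasDerivAt_id (0 : ℝ)
  have h1 := hs.const_sub 1
  have hpoly := (((h1.pow 2).mul_const (r₀ ^ 2)).add ((hs.pow 2).mul_const (r₁ ^ 2))).add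
    (((((hs.const_mul 2).mul h1).mul_const r₀).mul_const r₁).mul_const (Real.cos ‖x₀ - x₁‖))
  refine (hpoly.sqrt (by simp [hr₀.ne'])).congr_deriv ?_
  simp [Real.sqrt_sq hr₀.le]
  field_simp
  ring

theorem coneGeoR_sq_eq {d : ℕ} (x₀ x₁ : EuclideanSpace ℝ (Fin d)) (r₀ r₁ s : ℝ) :
    coneGeoR x₀ x₁ r₀ r₁ s ^ 2 = ((1 - s) * r₀ + s * r₁ * Real.cos ‖x₀ - x₁‖) ^ 2 +
      (s * r₁ * Real.sin ‖x₀ - x₁‖) ^ 2 := by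
  have h : (1 - s) ^ 2 * r₀ ^ 2 + s ^ 2 * r₁ ^ 2 +
      2 * s * (1 - s) * r₀ * r₁ * Real.cos ‖x₀ - x₁‖ =
      ((1 - s) * r₀ + s * r₁ * Real.cos ‖x₀ - x₁‖) ^ 2 +
      (s * r₁ * Real.sin ‖x₀ - x₁‖) ^ 2 := by
    linear_combination (-(s ^ 2 * r₁ ^ 2)) * Real.sin_sq_add_cos_sq ‖x₀ - x₁‖
  rw [coneGeoR, h, Real.sq_sqrt (by positivity)]

theorem coneGeoRho_eq_arcsin {d : ℕ} {x₀ x₁ : EuclideanSpace ℝ (Fin d)} {r₀ r₁ s : ℝ}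
    (hR : 0 < coneGeoR x₀ x₁ r₀ r₁ s)
    (hcos : 0 ≤ (1 - s) * r₀ + s * r₁ * Real.cos ‖x₀ - x₁‖)
    (hsin : 0 ≤ s * r₁ * Real.sin ‖x₀ - x₁‖) :
    coneGeoRho x₀ x₁ r₀ r₁ s =
      Real.arcsin (s * r₁ * Real.sin ‖x₀ - x₁‖ / coneGeoR x₀ x₁ r₀ r₁ s) / ‖x₀ - x₁‖ := by
  have hsq : 1 - (((1 - s) * r₀ + s * r₁ * Real.cos ‖x₀ - x₁‖) / coneGeoR x₀ x₁ r₀ r₁ s) ^ 2 =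
      (s * r₁ * Real.sin ‖x₀ - x₁‖ / coneGeoR x₀ x₁ r₀ r₁ s) ^ 2 := by
    field_simp
    linear_combination coneGeoR_sq_eq x₀ x₁ r₀ r₁ s
  rw [coneGeoRho, Real.arccos_eq_arcsin (by positivity), hsq, Real.sqrt_sq (by positivity)]

theorem tendsto_coneGeoRho_div {d : ℕ} {x₀ x₁ : EuclideanSpace ℝ (Fin d)} {r₀ r₁ : ℝ}
    (hr₀ : 0 < r₀) (hr₁ : 0 ≤ r₁) (hθ : ‖x₀ - x₁‖ ≤ π) :
    Tendsto (fun s => s⁻¹ * coneGeoRho x₀ x₁ r₀ r₁ s) (nhdsWithin 0 (Set.Ioi 0))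
      (nhds (Real.sin ‖x₀ - x₁‖ * r₁ / (‖x₀ - x₁‖ * r₀))) := by
  have hR := hasDerivAt_coneGeoR_zero x₀ x₁ r₁ hr₀
  have hR0 := coneGeoR_zero x₀ x₁ r₁ hr₀.le
  have hquot : HasDerivAt
      (fun s => s * r₁ * Real.sin ‖x₀ - x₁‖ / coneGeoR x₀ x₁ r₀ r₁ s)
      (r₁ * Real.sin ‖x₀ - x₁‖ / r₀) 0 := by
    refine ((((hasDerivAt_id (0 : ℝ)).mul_const r₁).mul_const
      (Real.sin ‖x₀ - x₁‖)).div hR (by rw [hR0]; exact hr₀.ne')).congr_deriv ?_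
    simp [hR0]
    field_simp
  have hasin : HasDerivAt Real.arcsin 1
      (0 * r₁ * Real.sin ‖x₀ - x₁‖ / coneGeoR x₀ x₁ r₀ r₁ 0) := by
    simpa using Real.hasDerivAt_arcsin (x := 0) (by norm_num) (by norm_num)
  have hderiv := ((hasin.comp 0 hquot).div_const ‖x₀ - x₁‖).tendsto_slope_zero_right
  have hRpos : ∀ᶠ s in nhdsWithin 0 (Set.Ioi 0), 0 < coneGeoR x₀ x₁ r₀ r₁ s :=
    nhdsWithin_le_nhds (hR.continuousAt.eventually (lt_mem_nhds (hR0.symm ▸ hr₀)))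
  have hcos : ∀ᶠ s in nhdsWithin 0 (Set.Ioi 0),
      0 < (1 - s) * r₀ + s * r₁ * Real.cos ‖x₀ - x₁‖ := by
    have hc : Continuous fun s : ℝ => (1 - s) * r₀ + s * r₁ * Real.cos ‖x₀ - x₁‖ := by fun_prop
    exact nhdsWithin_le_nhds (hc.continuousAt.eventually (lt_mem_nhds (by simpa using hr₀)))
  have heq : Real.sin ‖x₀ - x₁‖ * r₁ / (‖x₀ - x₁‖ * r₀) =
      1 * (r₁ * Real.sin ‖x₀ - x₁‖ / r₀) / ‖x₀ - x₁‖ := by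
    rw [one_mul, div_div, mul_comm r₁, mul_comm r₀]
  rw [heq]
  refine hderiv.congr' ?_
  filter_upwards [hRpos, hcos, self_mem_nhdsWithin] with s hs hs' hspos
  have hsin := Real.sin_nonneg_of_nonneg_of_le_pi (norm_nonneg (x₀ - x₁)) hθ
  have hs0 : 0 < s := hspos
  rw [coneGeoRho_eq_arcsin hs hs'.le (by positivity)]
  simp

/-- The one-sided derivatives at `s = 0` of the cone geodesic interpolation exist and equal
`lim_{s→0⁺} (X(s) − x₀)/s = (sin θ · r₁/(θ r₀)) (x₁ − x₀)` and
`lim_{s→0⁺} (R(s) − r₀)/s = r₁ cos θ − r₀`, where `θ = ‖x₁ − x₀‖ ∈ (0, π)`. -/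
theorem cone_geodesic_one_sided_derivatives {d : ℕ}
    (x₀ x₁ : EuclideanSpace ℝ (Fin d)) (r₀ r₁ : ℝ)
    (hr₀ : 0 < r₀) (hr₁ : 0 < r₁)
    (hθ : 0 < ‖x₁ - x₀‖) (hθ' : ‖x₁ - x₀‖ < π) :
    Tendsto (fun s : ℝ => s⁻¹ • (coneGeoX x₀ x₁ r₀ r₁ s - x₀))
      (nhdsWithin 0 (Set.Ioi 0))
      (nhds ((Real.sin ‖x₁ - x₀‖ * r₁ / (‖x₁ - x₀‖ * r₀)) • (x₁ - x₀))) ∧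
    Tendsto (fun s : ℝ => (coneGeoR x₀ x₁ r₀ r₁ s - r₀) / s)
      (nhdsWithin 0 (Set.Ioi 0))
      (nhds (r₁ * Real.cos ‖x₁ - x₀‖ - r₀)) := by
  rw [norm_sub_rev x₁ x₀] at hθ' ⊢
  constructor
  · refine ((tendsto_coneGeoRho_div hr₀ hr₁.le hθ'.le).smul_const (x₁ - x₀)).congr fun s => ?_
    rw [coneGeoX, mul_smul]
    congr 1
    module
  · refine (hasDerivAt_coneGeoR_zero x₀ x₁ r₁ hr₀).tendsto_slope_zero_right.congr fun s => ?_
    rw [zero_add, coneGeoR_zero x₀ x₁ r₁ hr₀.le, smul_eq_mul, div_eq_inv_mul]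

end
end

section
/- Let x₀ ∈ ℝ^d, r₀ > 0, v_x ∈ ℝ^d with v_x ≠ 0, and v_r ∈ ℝ. Define r₁ = sqrt(‖v_x‖² r₀² + (v_r + r₀)²), let θ ∈ (0, π) be the unique angle with cos θ = (v_r + r₀)/r₁ and sin θ = r₀‖v_x‖/r₁, and set x₁ = x₀ + θ · v_x/‖v_x‖. Then r₁ > 0, ‖x₁ − x₀‖ = θ, (sin(‖x₁ − x₀‖) · r₁ / (‖x₁ − x₀‖ · r₀)) · (x₁ − x₀) = v_x, and r₁ cos(‖x₁ − x₀‖) − r₀ = v_r. In other words, the explicit cone exponential map inverts the cone logarithmic map. -/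
open Real

noncomputable section

/-- The explicit cone exponential map inverts the cone logarithmic map: with
`r₁ = sqrt(‖v_x‖² r₀² + (v_r + r₀)²)`, `θ ∈ (0,π)` the unique angle with
`cos θ = (v_r + r₀)/r₁` and `sin θ = r₀‖v_x‖/r₁`, and `x₁ = x₀ + θ v_x/‖v_x‖`, we have
`r₁ > 0`, `‖x₁ − x₀‖ = θ`, and the logarithmic-map components at `(x₀,r₀)` of `(x₁,r₁)`
recover `(v_x, v_r)`. -/
theorem cone_exp_inverts_log {d : ℕ}
    (x₀ : EuclideanSpace ℝ (Fin d)) (r₀ : ℝ) (hr₀ : 0 < r₀)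
    (vx : EuclideanSpace ℝ (Fin d)) (hvx : vx ≠ 0) (vr : ℝ)
    (r₁ θ : ℝ)
    (hr₁ : r₁ = Real.sqrt (‖vx‖ ^ 2 * r₀ ^ 2 + (vr + r₀) ^ 2))
    (hθmem : θ ∈ Set.Ioo 0 π)
    (hcos : Real.cos θ = (vr + r₀) / r₁)
    (hsin : Real.sin θ = r₀ * ‖vx‖ / r₁)
    (x₁ : EuclideanSpace ℝ (Fin d))
    (hx₁ : x₁ = x₀ + θ • ‖vx‖⁻¹ • vx) :
    0 < r₁ ∧ ‖x₁ - x₀‖ = θ ∧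
      (Real.sin ‖x₁ - x₀‖ * r₁ / (‖x₁ - x₀‖ * r₀)) • (x₁ - x₀) = vx ∧
      r₁ * Real.cos ‖x₁ - x₀‖ - r₀ = vr := by
  obtain ⟨hθ, -⟩ := hθmem
  have hv : 0 < ‖vx‖ := norm_pos_iff.mpr hvx
  have hr₁_pos : 0 < r₁ := by
    rw [hr₁]
    positivity
  have hsub : x₁ - x₀ = θ • ‖vx‖⁻¹ • vx := by rw [hx₁, add_sub_cancel_left]
  have hnorm : ‖x₁ - x₀‖ = θ := by
    rw [hsub, norm_smul, norm_smul, norm_inv, norm_norm, inv_mul_cancel₀ hv.ne', mul_one,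
      Real.norm_of_nonneg hθ.le]
  refine ⟨hr₁_pos, hnorm, ?_, ?_⟩
  · rw [hnorm, hsub, hsin, smul_smul, smul_smul]
    have hcoef : r₀ * ‖vx‖ / r₁ * r₁ / (θ * r₀) * θ * ‖vx‖⁻¹ = 1 := by
      field_simp
    rw [hcoef, one_smul]
  · rw [hnorm, hcos, mul_div_cancel₀ _ hr₁_pos.ne', add_sub_cancel_right]

end
end

section
/- Let s > 0, r₀ > 0, ρ₀ ∈ ℝ with ρ₀² < s², set c = r₀ sqrt(s² − ρ₀²), and let e ∈ ℝ^d with ‖e‖ = 1. Define r(t) = sqrt(s²t² + 2 r₀ ρ₀ t + r₀²), v(t) = (c / r(t)²) e, and θ(t) = arctan((s² t + r₀ ρ₀)/c) − arctan(r₀ ρ₀ / c). Given a₀ ∈ ℝ^d and b₀ ∈ ℝ, write α₀ = ⟨a₀, e⟩ and a₀^⊥ = a₀ − α₀ e, and define a(t) = (r₀ / r(t)) a₀^⊥ + ((r₀ α₀ cos θ(t) − b₀ sin θ(t)) / r(t)) e and b(t) = r₀ α₀ sin θ(t) + b₀ cos θ(t). Then a(0) = a₀, b(0) = b₀, and for all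 t ∈ ℝ the parallel transport equations hold: a'(t) + (r'(t)/r(t)) a(t) + (b(t)/r(t)) v(t) = 0 and b'(t) = r(t) ⟨a(t), v(t)⟩. -/
open Real
open scoped RealInnerProductSpace

noncomputable section

/-- If `c² = r₀² (s² - ρ₀²)`, completing the square in the squared radius of the cone geodesic
gives a sum of squares. -/
theorem sq_mul_cone_radius_sq {s r₀ ρ₀ c : ℝ} (hc : c ^ 2 = r₀ ^ 2 * (s ^ 2 - ρ₀ ^ 2)) (t : ℝ) :
    s ^ 2 * (s ^ 2 * t ^ 2 + 2 * r₀ * ρ₀ * t + r₀ ^ 2) = c ^ 2 + (s ^ 2 * t + r₀ * ρ₀) ^ 2 := by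
  rw [hc]; ring

/-- The squared radius of a cone geodesic that misses the apex is positive. -/
theorem cone_radius_sq_pos {s r₀ ρ₀ c : ℝ} (hs : 0 < s) (hc₀ : 0 < c)
    (hc : c ^ 2 = r₀ ^ 2 * (s ^ 2 - ρ₀ ^ 2)) (t : ℝ) :
    0 < s ^ 2 * t ^ 2 + 2 * r₀ * ρ₀ * t + r₀ ^ 2 := by
  refine pos_of_mul_pos_right (a := s ^ 2) ?_ (by positivity)
  rw [sq_mul_cone_radius_sq hc]
  positivity

/-- The angle swept out along a cone geodesic has derivative `c / r²`. -/
theorem hasDerivAt_cone_angle {s r₀ ρ₀ c : ℝ} (hs : 0 < s) (hc₀ : 0 < c)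
    (hc : c ^ 2 = r₀ ^ 2 * (s ^ 2 - ρ₀ ^ 2)) (t : ℝ) :
    HasDerivAt (fun t => arctan ((s ^ 2 * t + r₀ * ρ₀) / c) - arctan (r₀ * ρ₀ / c))
      (c / (s ^ 2 * t ^ 2 + 2 * r₀ * ρ₀ * t + r₀ ^ 2)) t := by
  have h := (((((hasDerivAt_id t).const_mul (s ^ 2)).add_const (r₀ * ρ₀)).div_const c).arctan
    ).sub_const (arctan (r₀ * ρ₀ / c))
  refine h.congr_deriv ?_
  have hpos := cone_radius_sq_pos hs hc₀ hc t
  have hsq := sq_mul_cone_radius_sq hc t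
  have hne : c ^ 2 + (s ^ 2 * t + r₀ * ρ₀) ^ 2 ≠ 0 := by positivity
  simp only [id_eq]
  rw [show 1 + ((s ^ 2 * t + r₀ * ρ₀) / c) ^ 2 = (c ^ 2 + (s ^ 2 * t + r₀ * ρ₀) ^ 2) / c ^ 2 by
    field_simp, ← hsq]
  generalize s ^ 2 * t ^ 2 + 2 * r₀ * ρ₀ * t + r₀ ^ 2 = R at hpos ⊢
  field_simp

/-- The explicit formulas for parallel transport along a constant-speed cone geodesic
satisfy the parallel transport equations
`a'(t) + (r'(t)/r(t)) a(t) + (b(t)/r(t)) v(t) = 0` and `b'(t) = r(t) ⟨a(t), v(t)⟩`,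
together with the initial conditions `a(0) = a₀`, `b(0) = b₀`. -/
theorem cone_parallel_transport_solves_ODE {d : ℕ}
    (s r₀ ρ₀ c : ℝ) (hs : 0 < s) (hr₀ : 0 < r₀) (hρ₀ : ρ₀ ^ 2 < s ^ 2)
    (hc : c = r₀ * Real.sqrt (s ^ 2 - ρ₀ ^ 2))
    (e : EuclideanSpace ℝ (Fin d)) (he : ‖e‖ = 1)
    (a₀ : EuclideanSpace ℝ (Fin d)) (b₀ : ℝ)
    (r : ℝ → ℝ)
    (hr : ∀ t, r t = Real.sqrt (s ^ 2 * t ^ 2 + 2 * r₀ * ρ₀ * t + r₀ ^ 2))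
    (v : ℝ → EuclideanSpace ℝ (Fin d))
    (hv : ∀ t, v t = (c / r t ^ 2) • e)
    (θ : ℝ → ℝ)
    (hθ : ∀ t, θ t = Real.arctan ((s ^ 2 * t + r₀ * ρ₀) / c)
        - Real.arctan (r₀ * ρ₀ / c))
    (α₀ : ℝ) (hα₀ : α₀ = ⟪a₀, e⟫)
    (aperp : EuclideanSpace ℝ (Fin d)) (haperp : aperp = a₀ - α₀ • e)
    (a : ℝ → EuclideanSpace ℝ (Fin d))
    (ha : ∀ t, a t = (r₀ / r t) • aperp +
        ((r₀ * α₀ * Real.cos (θ t) - b₀ * Real.sin (θ t)) / r t) • e)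
    (b : ℝ → ℝ)
    (hb : ∀ t, b t = r₀ * α₀ * Real.sin (θ t) + b₀ * Real.cos (θ t)) :
    a 0 = a₀ ∧ b 0 = b₀ ∧
      ∀ t : ℝ,
        HasDerivAt a (-((deriv r t / r t) • a t + (b t / r t) • v t)) t ∧
        HasDerivAt b (r t * ⟪a t, v t⟫) t := by
  have hd : 0 < s ^ 2 - ρ₀ ^ 2 := sub_pos.mpr hρ₀
  have hc₀ : 0 < c := hc ▸ mul_pos hr₀ (sqrt_pos.mpr hd)
  have hc₂ : c ^ 2 = r₀ ^ 2 * (s ^ 2 - ρ₀ ^ 2) := by rw [hc, mul_pow, sq_sqrt hd.le]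
  have hR := cone_radius_sq_pos hs hc₀ hc₂
  have hr_pos : ∀ t, 0 < r t := fun t => hr t ▸ sqrt_pos.mpr (hR t)
  have hr_sq : ∀ t, r t ^ 2 = s ^ 2 * t ^ 2 + 2 * r₀ * ρ₀ * t + r₀ ^ 2 := fun t => by
    rw [hr, sq_sqrt (hR t).le]
  have hr_zero : r 0 = r₀ := by simp [hr, sqrt_sq hr₀.le]
  have hθ_zero : θ 0 = 0 := by simp [hθ]
  have he_inner : ⟪e, e⟫ = 1 := by rw [real_inner_self_eq_norm_sq, he, one_pow]
  have h_perp : ⟪aperp, e⟫ = 0 := by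
    rw [haperp, inner_sub_left, real_inner_smul_left, he_inner, hα₀, mul_one, sub_self]
  refine ⟨?_, ?_, fun t => ?_⟩
  · simp [ha, hr_zero, hθ_zero, haperp, hr₀.ne']
  · simp [hb, hθ_zero]
  have hr_ne := (hr_pos t).ne'
  have hθ' : HasDerivAt θ (c / r t ^ 2) t := by
    rw [hr_sq, funext hθ]
    exact hasDerivAt_cone_angle hs hc₀ hc₂ t
  have hr' : HasDerivAt r (deriv r t) t := by
    refine DifferentiableAt.hasDerivAt ?_
    rw [funext hr]
    exact DifferentiableAt.sqrt (by fun_prop) (hR t).ne'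
  constructor
  · rw [funext ha]
    have h₁ := ((hasDerivAt_const t r₀).fun_div hr' hr_ne).smul_const aperp
    have h₂ := ((((hθ'.cos.const_mul (r₀ * α₀)).fun_sub (hθ'.sin.const_mul b₀)).fun_div
      hr' hr_ne)).smul_const e
    refine (h₁.fun_add h₂).congr_deriv ?_
    rw [hv, hb]
    match_scalars <;> field_simp <;> ring
  · have h := (hθ'.sin.const_mul (r₀ * α₀)).fun_add (hθ'.cos.const_mul b₀)
    rw [funext hb]
    refine h.congr_deriv ?_
    rw [ha, hv, real_inner_smul_right, inner_add_left, real_inner_smul_left, real_inner_smul_left,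
      h_perp, he_inner]
    field_simp
    ring

end
end

section
/- Let λ be a finite measure on ℝ^d × (0,∞) whose support is contained in ℝ^d × [r_min, r_max] for some 0 < r_min ≤ r_max < ∞, let μ = 𝔓λ, and let U ⊆ ℝ^d be open. For Φ ∈ C_c^∞(ℝ^d × (0,∞)), define the cone gradient ∇_CΦ(x,r) = (r⁻² ∇_xΦ(x,r), ∂_rΦ(x,r)). If the pair (v,β) belongs to the closure of the set {(∇φ, φ) : φ ∈ C_c^∞(U)} in L²(μ;ℝ^d) × L²(μ;ℝ), then the lifted field ℒ(v,β)(x,r) = (v(x), 2β(x)r) belongs to the closure of {∇_CΦ : Φ ∈ C_c^∞(ℝ^d × (0,∞))} in the space of cone vector fields with squared norm ∫ (r²‖a(x,r)‖² + b(x,r)²) dλ(x,r). -/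
open Real MeasureTheory
open scoped RealInnerProductSpace ENNReal

noncomputable section

/-- Projection of a cone measure to the base space: `∫ φ d(𝔓λ) = ∫ r² φ(x) dλ(x,r)`. -/
def coneMeasureProj {d : ℕ} (lam : Measure (EuclideanSpace ℝ (Fin d) × ℝ)) :
    Measure (EuclideanSpace ℝ (Fin d)) :=
  (lam.withDensity fun p => ENNReal.ofReal (p.2 ^ 2)).map Prod.fst

/-- The cone gradient of a function `Φ` on `ℝ^d × (0,∞)`:
`∇_C Φ(x,r) = (r⁻² ∇ₓΦ(x,r), ∂_rΦ(x,r))`. -/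
def coneGradient {d : ℕ} (Φ : EuclideanSpace ℝ (Fin d) × ℝ → ℝ)
    (p : EuclideanSpace ℝ (Fin d) × ℝ) : EuclideanSpace ℝ (Fin d) × ℝ :=
  ((p.2 ^ 2)⁻¹ • gradient (fun y => Φ (y, p.2)) p.1,
    deriv (fun ρ => Φ (p.1, ρ)) p.2)

theorem ContDiff.continuous_gradient {F : Type*} [NormedAddCommGroup F] [InnerProductSpace ℝ F]
    [CompleteSpace F] {φ : F → ℝ} {n : WithTop ℕ∞} (hφ : ContDiff ℝ n φ) (hn : n ≠ 0) :
    Continuous (gradient φ) :=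
  (InnerProductSpace.toDual ℝ F).symm.continuous.comp (hφ.continuous_fderiv hn)

theorem HasCompactSupport.gradient {F : Type*} [NormedAddCommGroup F] [InnerProductSpace ℝ F]
    [CompleteSpace F] {φ : F → ℝ} (hφ : HasCompactSupport φ) :
    HasCompactSupport (gradient φ) :=
  (hφ.fderiv ℝ).comp_left (g := (InnerProductSpace.toDual ℝ F).symm) (map_zero _)

theorem gradient_const_mul {F : Type*} [NormedAddCommGroup F] [InnerProductSpace ℝ F]
    [CompleteSpace F] {φ : F → ℝ} {x : F} (hφ : DifferentiableAt ℝ φ x) (c : ℝ) :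
    gradient (fun y => c * φ y) x = c • gradient φ x := by
  simp [gradient, fderiv_const_mul hφ c]

/-- A smooth cutoff equal to `1` near `[a, b] ⊆ (0,∞)` and compactly supported in `(0,∞)`. -/
theorem exists_contDiff_cutoff_Icc {a b : ℝ} (ha : 0 < a) (hab : a ≤ b) :
    ∃ χ : ℝ → ℝ, ContDiff ℝ (⊤ : ℕ∞) χ ∧ HasCompactSupport χ ∧ tsupport χ ⊆ Set.Ioi 0 ∧
      ∀ r ∈ Set.Icc a b, χ =ᶠ[nhds r] 1 := by
  let f : ContDiffBump ((a + b) / 2) :=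
    { rIn := (b - a) / 2 + a / 4
      rOut := (b - a) / 2 + a / 2
      rIn_pos := by linarith
      rIn_lt_rOut := by linarith }
  refine ⟨f, f.contDiff, f.hasCompactSupport, ?_, fun r hr => ?_⟩
  · rw [f.tsupport_eq, Real.closedBall_eq_Icc]
    intro x hx
    have h := hx.1
    simp only [f] at h
    rw [Set.mem_Ioi]
    linarith
  · apply f.eventuallyEq_one_of_mem_ball
    simp only [f, Real.ball_eq_Ioo, Set.mem_Ioo]
    exact ⟨by linarith [hr.1], by linarith [hr.2]⟩

theorem integrable_coneMeasureProj_iff {d : ℕ} {lam : Measure (EuclideanSpace ℝ (Fin d) × ℝ)}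
    {g : EuclideanSpace ℝ (Fin d) → ℝ} (hg : AEStronglyMeasurable g (coneMeasureProj lam)) :
    Integrable g (coneMeasureProj lam) ↔ Integrable (fun p => p.2 ^ 2 * g p.1) lam := by
  rw [coneMeasureProj, integrable_map_measure hg measurable_fst.aemeasurable,
    integrable_withDensity_iff_integrable_smul' (by fun_prop) (by simp)]
  simp [ENNReal.toReal_ofReal, sq_nonneg]

theorem integral_coneMeasureProj {d : ℕ} {lam : Measure (EuclideanSpace ℝ (Fin d) × ℝ)}
    {g : EuclideanSpace ℝ (Fin d) → ℝ} (hg : AEStronglyMeasurable g (coneMeasureProj lam)) :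
    ∫ x, g x ∂coneMeasureProj lam = ∫ p, p.2 ^ 2 * g p.1 ∂lam := by
  rw [coneMeasureProj, integral_map measurable_fst.aemeasurable hg,
    integral_withDensity_eq_integral_toReal_smul (by fun_prop) (by simp)]
  simp [ENNReal.toReal_ofReal, sq_nonneg]

theorem isFiniteMeasure_coneMeasureProj {d : ℕ}
    {lam : Measure (EuclideanSpace ℝ (Fin d) × ℝ)} [IsFiniteMeasure lam] {R : ℝ}
    (h : ∀ᵐ p ∂lam, p.2 ^ 2 ≤ R) : IsFiniteMeasure (coneMeasureProj lam) := by
  have : IsFiniteMeasure (lam.withDensity fun p => ENNReal.ofReal (p.2 ^ 2)) := by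
    apply isFiniteMeasure_withDensity
    refine ((lintegral_mono_ae (h.mono fun p hp => ENNReal.ofReal_le_ofReal hp)).trans_lt ?_).ne
    rw [lintegral_const]
    exact ENNReal.mul_lt_top ENNReal.ofReal_lt_top (measure_lt_top _ _)
  unfold coneMeasureProj
  infer_instance

/-- The potential `(x, r) ↦ r² χ(r) φ(x)` has the lift of `(∇φ, φ)` as its cone gradient wherever
the cutoff `χ` is locally `1`. -/
theorem coneGradient_sq_mul_cutoff {d : ℕ} {φ : EuclideanSpace ℝ (Fin d) → ℝ} {χ : ℝ → ℝ}
    {x : EuclideanSpace ℝ (Fin d)} {r : ℝ} (hφ : DifferentiableAt ℝ φ x) (hr : r ≠ 0)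
    (hχ : χ =ᶠ[nhds r] 1) :
    coneGradient (fun p => p.2 ^ 2 * χ p.2 * φ p.1) (x, r) = (gradient φ x, 2 * φ x * r) := by
  have hderiv : deriv (fun ρ => ρ ^ 2 * χ ρ * φ x) r = 2 * φ x * r := by
    have h : (fun ρ => ρ ^ 2 * χ ρ * φ x) =ᶠ[nhds r] fun ρ => ρ ^ 2 * φ x := by
      filter_upwards [hχ] with ρ hρ
      simp [hρ]
    rw [h.deriv_eq, deriv_mul_const (by fun_prop)]
    simp
    ring
  have h1 : χ r = 1 := hχ.eq_of_nhds
  simp only [coneGradient, hderiv, gradient_const_mul hφ, h1, mul_one]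
  rw [smul_smul, inv_mul_cancel₀ (pow_ne_zero 2 hr), one_smul]

/-- If `(v, β)` lies in the `L²(μ;ℝ^d) × L²(μ;ℝ)` closure of `{(∇φ, φ) : φ ∈ C_c^∞(U)}`,
where `μ = 𝔓λ`, then the lifted field `ℒ(v,β)(x,r) = (v(x), 2β(x)r)` lies in the closure of
the set of cone gradients of `C_c^∞(ℝ^d × (0,∞))` functions, in the cone-weighted `L²(λ)`
norm `∫ (r²‖a‖² + b²) dλ`. -/
theorem lifted_field_in_cone_tangent {d : ℕ}
    (lam : Measure (EuclideanSpace ℝ (Fin d) × ℝ)) [IsFiniteMeasure lam]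
    (rmin rmax : ℝ) (hrmin : 0 < rmin) (hrr : rmin ≤ rmax)
    (hsupp : lam {p | p.2 ∉ Set.Icc rmin rmax} = 0)
    (U : Set (EuclideanSpace ℝ (Fin d))) (hU : IsOpen U)
    (v : EuclideanSpace ℝ (Fin d) → EuclideanSpace ℝ (Fin d))
    (β : EuclideanSpace ℝ (Fin d) → ℝ)
    (hv : AEStronglyMeasurable v (coneMeasureProj lam))
    (hβ : AEStronglyMeasurable β (coneMeasureProj lam))
    (hvL2 : Integrable (fun x => ‖v x‖ ^ 2) (coneMeasureProj lam))
    (hβL2 : Integrable (fun x => β x ^ 2) (coneMeasureProj lam))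
    (hclos : ∀ ε > 0, ∃ φ : EuclideanSpace ℝ (Fin d) → ℝ,
      ContDiff ℝ (⊤ : ℕ∞) φ ∧ HasCompactSupport φ ∧ tsupport φ ⊆ U ∧
      ∫ x, (‖v x - gradient φ x‖ ^ 2 + (β x - φ x) ^ 2) ∂(coneMeasureProj lam) < ε) :
    ∀ ε > 0, ∃ Φ : EuclideanSpace ℝ (Fin d) × ℝ → ℝ,
      ContDiff ℝ (⊤ : ℕ∞) Φ ∧ HasCompactSupport Φ ∧
      tsupport Φ ⊆ Set.univ ×ˢ Set.Ioi (0 : ℝ) ∧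
      ∫ p, (p.2 ^ 2 * ‖v p.1 - (coneGradient Φ p).1‖ ^ 2 +
        (2 * β p.1 * p.2 - (coneGradient Φ p).2) ^ 2) ∂lam < ε := by
  intro ε hε
  have hae : ∀ᵐ p ∂lam, p.2 ∈ Set.Icc rmin rmax := ae_iff.2 hsupp
  have hfin : IsFiniteMeasure (coneMeasureProj lam) :=
    isFiniteMeasure_coneMeasureProj (R := rmax ^ 2) <| hae.mono fun p hp =>
      pow_le_pow_left₀ (hrmin.le.trans hp.1) hp.2 2
  obtain ⟨φ, hφ, hφc, -, hφε⟩ := hclos (ε / 4) (by positivity)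
  obtain ⟨χ, hχ, hχc, hχpos, hχ1⟩ := exists_contDiff_cutoff_Icc hrmin hrr
  have hgrad : MemLp (gradient φ) 2 (coneMeasureProj lam) :=
    (hφ.continuous_gradient (by simp)).memLp_of_hasCompactSupport hφc.gradient
  have hφ2 : MemLp φ 2 (coneMeasureProj lam) := hφ.continuous.memLp_of_hasCompactSupport hφc
  have hint : Integrable (fun x => ‖v x - gradient φ x‖ ^ 2 + (β x - φ x) ^ 2)
      (coneMeasureProj lam) :=
    (((memLp_two_iff_integrable_sq_norm hv).2 hvL2).sub hgrad).integrable_norm_pow (by simp)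
      |>.add (((memLp_two_iff_integrable_sq hβ).2 hβL2).sub hφ2).integrable_sq
  have hsub : tsupport (fun p : EuclideanSpace ℝ (Fin d) × ℝ => p.2 ^ 2 * χ p.2 * φ p.1) ⊆
      tsupport φ ×ˢ tsupport χ := by
    refine closure_minimal (fun p hp => ?_) ((isClosed_tsupport φ).prod (isClosed_tsupport χ))
    have hp' : p.2 ^ 2 * χ p.2 * φ p.1 ≠ 0 := hp
    exact ⟨subset_tsupport _ (right_ne_zero_of_mul hp'),
      subset_tsupport _ (right_ne_zero_of_mul (left_ne_zero_of_mul hp'))⟩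
  refine ⟨fun p => p.2 ^ 2 * χ p.2 * φ p.1, ?_, ?_, ?_, ?_⟩
  · exact ((contDiff_snd.pow 2).mul (hχ.comp contDiff_snd)).mul (hφ.comp contDiff_fst)
  · exact (hφc.prod hχc).of_isClosed_subset (isClosed_tsupport _) hsub
  · exact hsub.trans (Set.prod_mono (Set.subset_univ _) hχpos)
  · have hint' := (integrable_coneMeasureProj_iff hint.aestronglyMeasurable).1 hint
    rw [integral_coneMeasureProj hint.aestronglyMeasurable] at hφε
    refine (integral_mono_of_nonneg (.of_forall fun p => by positivity) (hint'.const_mul 4)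
      ?_).trans_lt (b := ∫ p, 4 * (p.2 ^ 2 * (‖v p.1 - gradient φ p.1‖ ^ 2 +
        (β p.1 - φ p.1) ^ 2)) ∂lam) ?_
    · filter_upwards [hae] with p hp
      have hc := coneGradient_sq_mul_cutoff (x := p.1) (hφ.differentiable (by simp) p.1)
        (hrmin.trans_le hp.1).ne' (hχ1 p.2 hp)
      rw [Prod.mk.eta] at hc
      simp only [hc]
      nlinarith [mul_nonneg (sq_nonneg p.2) (sq_nonneg ‖v p.1 - gradient φ p.1‖)]
    · rw [integral_const_mul]
      linarith

end
end

section
/- Let η be a finite measure on ℝ^d and r : ℝ^d → (0,∞) measurable with both r and 1/r bounded; let λ = G_#η with G(x) = (x, r(x)) and μ = 𝔓λ. Let H_μ = L²(μ;ℝ^d) × L²(μ;ℝ) with the Hellinger–Kantorovich inner product, and let H_λ be the Hilbert space of cone vector fields u with ∫ ‖u‖_C² dλ < ∞ and inner product ∫ ⟨u,w⟩_C dλ. Let T_μ ⊆ H_μ be the closure of {(∇φ, φ) : φ ∈ C_c^∞(ℝ^d)}, and let Π_μ be the orthogonal projection of H_μ onto T_μ. Then the operator Π^S = ℒ ∘ Π_μ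 ∘ 𝒫 : H_λ → H_λ is linear, idempotent, and self-adjoint; consequently ℒ(T_μ) is a closed subspace of H_λ and Π^S is the orthogonal projection of H_λ onto ℒ(T_μ). -/
open Real MeasureTheory
open scoped RealInnerProductSpace ENNReal

noncomputable section

/-- The lifting operator, acting on a pair `(v,β)`: `ℒ(v,β)(x,r) = (v(x), 2β(x)r)`. -/
def coneLift {d : ℕ}
    (f : (EuclideanSpace ℝ (Fin d) → EuclideanSpace ℝ (Fin d)) ×
      (EuclideanSpace ℝ (Fin d) → ℝ)) :
    EuclideanSpace ℝ (Fin d) × ℝ → EuclideanSpace ℝ (Fin d) × ℝ :=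
  fun p => (f.1 p.1, 2 * f.2 p.1 * p.2)

/-- The projection operator along the deterministic lift `x ↦ (x, r(x))`:
`𝒫u(x) = (a(x,r(x)), b(x,r(x))/(2r(x)))` for `u = (a,b)`. -/
def coneProjOp {d : ℕ} (r : EuclideanSpace ℝ (Fin d) → ℝ)
    (u : EuclideanSpace ℝ (Fin d) × ℝ → EuclideanSpace ℝ (Fin d) × ℝ) :
    (EuclideanSpace ℝ (Fin d) → EuclideanSpace ℝ (Fin d)) ×
      (EuclideanSpace ℝ (Fin d) → ℝ) :=
  (fun x => (u (x, r x)).1, fun x => (u (x, r x)).2 / (2 * r x))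

/-- The cone-weighted inner product `∫ ⟨u,w⟩_C dλ` of two cone vector fields. -/
def coneInner {d : ℕ} (lam : Measure (EuclideanSpace ℝ (Fin d) × ℝ))
    (u w : EuclideanSpace ℝ (Fin d) × ℝ → EuclideanSpace ℝ (Fin d) × ℝ) : ℝ :=
  ∫ p, (p.2 ^ 2 * ⟪(u p).1, (w p).1⟫ + (u p).2 * (w p).2) ∂lam

/-- Membership in `H_μ = L²(μ;ℝ^d) × L²(μ;ℝ)`. -/
def memHμ {d : ℕ} (μ : Measure (EuclideanSpace ℝ (Fin d)))
    (f : (EuclideanSpace ℝ (Fin d) → EuclideanSpace ℝ (Fin d)) ×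
      (EuclideanSpace ℝ (Fin d) → ℝ)) : Prop :=
  AEStronglyMeasurable f.1 μ ∧ AEStronglyMeasurable f.2 μ ∧
    Integrable (fun x => ‖f.1 x‖ ^ 2) μ ∧ Integrable (fun x => f.2 x ^ 2) μ

/-- Membership in `H_λ`, the cone-weighted `L²(λ)` space of cone vector fields. -/
def memHLam {d : ℕ} (lam : Measure (EuclideanSpace ℝ (Fin d) × ℝ))
    (u : EuclideanSpace ℝ (Fin d) × ℝ → EuclideanSpace ℝ (Fin d) × ℝ) : Prop :=
  AEStronglyMeasurable u lam ∧
    Integrable (fun p => p.2 ^ 2 * ‖(u p).1‖ ^ 2 + (u p).2 ^ 2) lam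

/-- Membership in `T_μ`: the Hellinger–Kantorovich `L²(μ)` closure of the set of pairs
`(∇φ, φ)` with `φ ∈ C_c^∞(ℝ^d)`. -/
def memTμ {d : ℕ} (μ : Measure (EuclideanSpace ℝ (Fin d)))
    (f : (EuclideanSpace ℝ (Fin d) → EuclideanSpace ℝ (Fin d)) ×
      (EuclideanSpace ℝ (Fin d) → ℝ)) : Prop :=
  memHμ μ f ∧ ∀ ε > 0, ∃ φ : EuclideanSpace ℝ (Fin d) → ℝ,
    ContDiff ℝ (⊤ : ℕ∞) φ ∧ HasCompactSupport φ ∧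
    ∫ x, (‖f.1 x - gradient φ x‖ ^ 2 + 4 * (f.2 x - φ x) ^ 2) ∂μ < ε

namespace HKProjection

variable {d : ℕ}

/-- Pairs of a vector field and a scalar field on `ℝ^d`. -/
abbrev Pair (d : ℕ) : Type :=
  (EuclideanSpace ℝ (Fin d) → EuclideanSpace ℝ (Fin d)) × (EuclideanSpace ℝ (Fin d) → ℝ)

/-- The `L²` space carrying the Hellinger–Kantorovich geometry. -/
abbrev HKSpace (μ : Measure (EuclideanSpace ℝ (Fin d))) : Type :=
  Lp (WithLp 2 (EuclideanSpace ℝ (Fin d) × ℝ)) 2 μ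

/-- The Hellinger–Kantorovich inner product. -/
def hkInner (μ : Measure (EuclideanSpace ℝ (Fin d))) (f g : Pair d) : ℝ :=
  ∫ x, (⟪f.1 x, g.1 x⟫ + 4 * f.2 x * g.2 x) ∂μ

/-- A pair `(v, β)` viewed as the field `(v, 2β)`, so that the Hellinger–Kantorovich inner
product becomes the usual `L²` one. -/
def hkField (f : Pair d) (x : EuclideanSpace ℝ (Fin d)) :
    WithLp 2 (EuclideanSpace ℝ (Fin d) × ℝ) :=
  WithLp.toLp 2 (f.1 x, 2 * f.2 x)

lemma inner_hkField (f g : Pair d) (x : EuclideanSpace ℝ (Fin d)) :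
    ⟪hkField f x, hkField g x⟫ = ⟪f.1 x, g.1 x⟫ + 4 * f.2 x * g.2 x := by
  simp [hkField, WithLp.prod_inner_apply]
  ring

lemma norm_sq_hkField (f : Pair d) (x : EuclideanSpace ℝ (Fin d)) :
    ‖hkField f x‖ ^ 2 = ‖f.1 x‖ ^ 2 + 4 * f.2 x ^ 2 := by
  rw [← real_inner_self_eq_norm_sq, inner_hkField, real_inner_self_eq_norm_sq]
  ring

lemma hkField_add (f g : Pair d) : hkField (f + g) = hkField f + hkField g := by
  ext x : 1
  simp only [hkField, Prod.fst_add, Prod.snd_add, Pi.add_apply, mul_add, ← WithLp.toLp_add,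
    Prod.mk_add_mk]

lemma hkField_smul (c : ℝ) (f : Pair d) : hkField (c • f) = c • hkField f := by
  ext x : 1
  simp only [hkField, Prod.smul_fst, Prod.smul_snd, Pi.smul_apply, ← WithLp.toLp_smul,
    Prod.smul_mk, smul_eq_mul, mul_left_comm]

lemma hkField_sub (f g : Pair d) : hkField (f - g) = hkField f - hkField g := by
  ext x : 1
  simp only [hkField, Prod.fst_sub, Prod.snd_sub, Pi.sub_apply, mul_sub, ← WithLp.toLp_sub,
    Prod.mk_sub_mk]

lemma hkField_eq_iff {f g : Pair d} {x : EuclideanSpace ℝ (Fin d)} :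
    hkField f x = hkField g x ↔ f.1 x = g.1 x ∧ f.2 x = g.2 x := by
  simp [hkField]

section Base

variable {μ : Measure (EuclideanSpace ℝ (Fin d))}

lemma memLp_hkField {f : Pair d} (hf : memHμ μ f) : MemLp (hkField f) 2 μ := by
  obtain ⟨h1, h2, h3, h4⟩ := hf
  have hmeas : AEStronglyMeasurable (hkField f) μ :=
    (WithLp.prod_continuous_toLp 2 _ _).comp_aestronglyMeasurable (h1.prodMk (h2.const_mul 2))
  rw [memLp_two_iff_integrable_sq_norm hmeas]
  simp only [norm_sq_hkField]
  exact h3.add (h4.const_mul 4)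

/-- The element of `HKSpace μ` given by a pair in `H_μ`. -/
def toHK {f : Pair d} (hf : memHμ μ f) : HKSpace μ := (memLp_hkField hf).toLp _

lemma inner_toHK {f g : Pair d} (hf : memHμ μ f) (hg : memHμ μ g) :
    ⟪toHK hf, toHK hg⟫ = hkInner μ f g := by
  rw [L2.inner_def, hkInner]
  refine integral_congr_ae ?_
  filter_upwards [(memLp_hkField hf).coeFn_toLp, (memLp_hkField hg).coeFn_toLp] with x hx hy
  rw [toHK, toHK, hx, hy, inner_hkField]

lemma memHμ_iff_memLp {f : Pair d} : memHμ μ f ↔ MemLp f.1 2 μ ∧ MemLp f.2 2 μ := by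
  constructor
  · rintro ⟨h1, h2, h3, h4⟩
    exact ⟨(memLp_two_iff_integrable_sq_norm h1).2 h3, (memLp_two_iff_integrable_sq h2).2 h4⟩
  · rintro ⟨h1, h2⟩
    exact ⟨h1.1, h2.1, (memLp_two_iff_integrable_sq_norm h1.1).1 h1,
      (memLp_two_iff_integrable_sq h2.1).1 h2⟩

lemma memHμ_add {f g : Pair d} (hf : memHμ μ f) (hg : memHμ μ g) : memHμ μ (f + g) := by
  rw [memHμ_iff_memLp] at *
  exact ⟨hf.1.add hg.1, hf.2.add hg.2⟩

lemma memHμ_sub {f g : Pair d} (hf : memHμ μ f) (hg : memHμ μ g) : memHμ μ (f - g) := by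
  rw [memHμ_iff_memLp] at *
  exact ⟨hf.1.sub hg.1, hf.2.sub hg.2⟩

lemma memHμ_smul (c : ℝ) {f : Pair d} (hf : memHμ μ f) : memHμ μ (c • f) := by
  rw [memHμ_iff_memLp] at *
  exact ⟨hf.1.const_smul c, hf.2.const_smul c⟩

lemma toHK_add {f g : Pair d} (hf : memHμ μ f) (hg : memHμ μ g) :
    toHK (memHμ_add hf hg) = toHK hf + toHK hg := by
  simp only [toHK, hkField_add]
  exact MemLp.toLp_add _ _

lemma toHK_sub {f g : Pair d} (hf : memHμ μ f) (hg : memHμ μ g) :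
    toHK (memHμ_sub hf hg) = toHK hf - toHK hg := by
  simp only [toHK, hkField_sub]
  exact MemLp.toLp_sub _ _

lemma toHK_smul (c : ℝ) {f : Pair d} (hf : memHμ μ f) :
    toHK (memHμ_smul c hf) = c • toHK hf := by
  simp only [toHK, hkField_smul]
  exact MemLp.toLp_const_smul _ _

lemma toHK_eq_iff {f g : Pair d} (hf : memHμ μ f) (hg : memHμ μ g) :
    toHK hf = toHK hg ↔ ∀ᵐ x ∂μ, f.1 x = g.1 x ∧ f.2 x = g.2 x := by
  rw [toHK, toHK, MemLp.toLp_eq_toLp_iff]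
  simp only [Filter.EventuallyEq, hkField_eq_iff]

lemma norm_sq_toHK_sub {f g : Pair d} (hf : memHμ μ f) (hg : memHμ μ g) :
    ‖toHK hf - toHK hg‖ ^ 2 = hkInner μ (f - g) (f - g) := by
  rw [← toHK_sub hf hg, ← real_inner_self_eq_norm_sq, inner_toHK]

/-- Membership in a closure follows from approximation in squared norm. -/
lemma mem_closure_of_norm_sq_sub_lt {H : Type*} [SeminormedAddCommGroup H] {S : Set H} {a : H}
    (h : ∀ ε > 0, ∃ b ∈ S, ‖a - b‖ ^ 2 < ε) : a ∈ closure S := by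
  rw [Metric.mem_closure_iff]
  intro ε hε
  obtain ⟨b, hb, hlt⟩ := h (ε ^ 2) (by positivity)
  exact ⟨b, hb, by rw [dist_eq_norm]; exact lt_of_pow_lt_pow_left₀ 2 hε.le hlt⟩

/-- The pair `(∇φ, φ)`. -/
def gradPair (φ : EuclideanSpace ℝ (Fin d) → ℝ) : Pair d := (gradient φ, φ)

variable [IsFiniteMeasure μ]

lemma memHμ_gradPair {φ : EuclideanSpace ℝ (Fin d) → ℝ} (hφ : ContDiff ℝ (⊤ : ℕ∞) φ)
    (hc : HasCompactSupport φ) : memHμ μ (gradPair φ) := by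
  rw [memHμ_iff_memLp]
  refine ⟨Continuous.memLp_of_hasCompactSupport ?_ ?_,
    hφ.continuous.memLp_of_hasCompactSupport hc⟩
  · exact (InnerProductSpace.toDual ℝ _).symm.continuous.comp
      (hφ.continuous_fderiv (by simp))
  · exact (hc.fderiv ℝ).comp_left
      (map_zero (InnerProductSpace.toDual ℝ (EuclideanSpace ℝ (Fin d))).symm)

variable (μ) in
/-- The elements of `HKSpace μ` of the form `(∇φ, φ)` with `φ` a test function. -/
def testFields : Set (HKSpace μ) :=
  {F | ∃ (φ : EuclideanSpace ℝ (Fin d) → ℝ) (hφ : ContDiff ℝ (⊤ : ℕ∞) φ)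
    (hc : HasCompactSupport φ), toHK (memHμ_gradPair hφ hc) = F}

variable (μ) in
/-- The tangent space as a closed subspace of `HKSpace μ`. -/
def tangent : Submodule ℝ (HKSpace μ) := (Submodule.span ℝ (testFields μ)).topologicalClosure

instance : CompleteSpace (tangent μ) :=
  (Submodule.isClosed_topologicalClosure _).completeSpace_coe

lemma toHK_mem_tangent {f : Pair d} (hf : memTμ μ f) : toHK hf.1 ∈ tangent μ := by
  refine closure_mono Submodule.subset_span (mem_closure_of_norm_sq_sub_lt fun ε hε => ?_)
  obtain ⟨φ, hφ, hc, hlt⟩ := hf.2 ε hε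
  refine ⟨_, ⟨φ, hφ, hc, rfl⟩, ?_⟩
  rw [norm_sq_toHK_sub]
  refine lt_of_eq_of_lt (integral_congr_ae (.of_forall fun x => ?_)) hlt
  simp only [gradPair, Prod.fst_sub, Prod.snd_sub, Pi.sub_apply, real_inner_self_eq_norm_sq]
  ring

lemma toHK_eq_starProjection {f g : Pair d} (hf : memHμ μ f) (hg : memTμ μ g)
    (horth : ∀ φ : EuclideanSpace ℝ (Fin d) → ℝ, ContDiff ℝ (⊤ : ℕ∞) φ → HasCompactSupport φ →
      hkInner μ (f - g) (gradPair φ) = 0) :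
    toHK hg.1 = (tangent μ).starProjection (toHK hf) := by
  refine (Submodule.eq_starProjection_of_mem_orthogonal (toHK_mem_tangent hg) ?_).symm
  rw [tangent, Submodule.orthogonal_closure, Submodule.mem_orthogonal']
  intro F hF
  induction hF using Submodule.span_induction with
  | mem F hF =>
    obtain ⟨φ, hφ, hc, rfl⟩ := hF
    rw [← toHK_sub hf hg.1, inner_toHK, horth φ hφ hc]
  | zero => exact inner_zero_right _
  | add F G _ _ hF hG => rw [inner_add_right, hF, hG, add_zero]
  | smul c F _ hF => rw [inner_smul_right, hF, mul_zero]

end Base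

section Cone

variable {r : EuclideanSpace ℝ (Fin d) → ℝ}

lemma measurableEmbedding_graph (hr : Measurable r) :
    MeasurableEmbedding fun x => (x, r x) :=
  (measurable_id.prodMk hr).measurableEmbedding fun _ _ h => congrArg Prod.fst h

lemma coneMeasureProj_map_graph (η : Measure (EuclideanSpace ℝ (Fin d))) (hr : Measurable r) :
    coneMeasureProj (η.map fun x => (x, r x)) =
      η.withDensity fun x => ((Real.toNNReal (r x ^ 2) : NNReal) : ℝ≥0∞) := by
  ext s hs
  have hG : Measurable fun x => (x, r x) := measurable_id.prodMk hr
  rw [coneMeasureProj, Measure.map_apply measurable_fst hs,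
    withDensity_apply _ (measurable_fst hs), withDensity_apply _ hs,
    setLIntegral_map (measurable_fst hs) (by fun_prop) hG]
  rfl

lemma coneProjOp_coneLift (hr : ∀ x, 0 < r x) (f : Pair d) : coneProjOp r (coneLift f) = f := by
  refine Prod.ext rfl (funext fun x => ?_)
  have := (hr x).ne'
  simp only [coneProjOp, coneLift]
  field_simp

lemma coneLift_coneProjOp (hr : ∀ x, 0 < r x)
    (u : EuclideanSpace ℝ (Fin d) × ℝ → EuclideanSpace ℝ (Fin d) × ℝ)
    (x : EuclideanSpace ℝ (Fin d)) : coneLift (coneProjOp r u) (x, r x) = u (x, r x) := by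
  have := (hr x).ne'
  refine Prod.ext rfl ?_
  simp only [coneProjOp, coneLift]
  field_simp

lemma coneProjOp_add (u w : EuclideanSpace ℝ (Fin d) × ℝ → EuclideanSpace ℝ (Fin d) × ℝ) :
    coneProjOp r (u + w) = coneProjOp r u + coneProjOp r w :=
  Prod.ext rfl (funext fun _ => add_div _ _ _)

lemma coneProjOp_sub (u w : EuclideanSpace ℝ (Fin d) × ℝ → EuclideanSpace ℝ (Fin d) × ℝ) :
    coneProjOp r (u - w) = coneProjOp r u - coneProjOp r w :=
  Prod.ext rfl (funext fun _ => sub_div _ _ _)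

lemma coneProjOp_smul (c : ℝ)
    (u : EuclideanSpace ℝ (Fin d) × ℝ → EuclideanSpace ℝ (Fin d) × ℝ) :
    coneProjOp r (c • u) = c • coneProjOp r u :=
  Prod.ext rfl (funext fun _ => mul_div_assoc _ _ _)

variable {η : Measure (EuclideanSpace ℝ (Fin d))}

lemma coneInner_map_graph (hr : Measurable r) (hpos : ∀ x, 0 < r x)
    (u w : EuclideanSpace ℝ (Fin d) × ℝ → EuclideanSpace ℝ (Fin d) × ℝ) :
    coneInner (η.map fun x => (x, r x)) u w =
      hkInner (coneMeasureProj (η.map fun x => (x, r x))) (coneProjOp r u) (coneProjOp r w) := by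
  rw [coneInner, hkInner, coneMeasureProj_map_graph η hr,
    (measurableEmbedding_graph hr).integral_map,
    integral_withDensity_eq_integral_smul (by fun_prop)]
  refine integral_congr_ae (.of_forall fun x => ?_)
  have := (hpos x).ne'
  simp only [coneProjOp, NNReal.smul_def, Real.coe_toNNReal _ (sq_nonneg _), smul_eq_mul]
  field_simp
  ring

lemma ae_map_graph_iff (hr : Measurable r) (hpos : ∀ x, 0 < r x)
    {p : EuclideanSpace ℝ (Fin d) × ℝ → Prop} :
    (∀ᵐ q ∂(η.map fun x => (x, r x)), p q) ↔
      ∀ᵐ x ∂(coneMeasureProj (η.map fun x => (x, r x))), p (x, r x) := by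
  rw [(measurableEmbedding_graph hr).ae_map_iff, coneMeasureProj_map_graph η hr,
    ae_withDensity_iff (by fun_prop)]
  simp [(hpos _).ne']

lemma isFiniteMeasure_coneMeasureProj [IsFiniteMeasure η] (hr : Measurable r)
    (hpos : ∀ x, 0 < r x) {C : ℝ} (hC : ∀ x, r x ≤ C) :
    IsFiniteMeasure (coneMeasureProj (η.map fun x => (x, r x))) := by
  rw [coneMeasureProj_map_graph η hr]
  refine isFiniteMeasure_withDensity (ne_of_lt ?_)
  calc ∫⁻ x, ((Real.toNNReal (r x ^ 2) : NNReal) : ℝ≥0∞) ∂η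
      ≤ ∫⁻ _, ((Real.toNNReal (C ^ 2) : NNReal) : ℝ≥0∞) ∂η := by
        refine lintegral_mono fun x => ?_
        have := pow_le_pow_left₀ (hpos x).le (hC x) 2
        gcongr
    _ < ∞ := by
        rw [lintegral_const]
        exact ENNReal.mul_lt_top ENNReal.coe_lt_top (measure_lt_top _ _)

lemma memHμ_coneProjOp (hr : Measurable r) (hpos : ∀ x, 0 < r x)
    {u : EuclideanSpace ℝ (Fin d) × ℝ → EuclideanSpace ℝ (Fin d) × ℝ}
    (hu : memHLam (η.map fun x => (x, r x)) u) :
    memHμ (coneMeasureProj (η.map fun x => (x, r x))) (coneProjOp r u) := by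
  obtain ⟨hm, hi⟩ := hu
  have hm' := hm.comp_measurable (measurable_id.prodMk hr)
  have hi' := (measurableEmbedding_graph hr).integrable_map_iff.1 hi
  have ha : AEStronglyMeasurable (fun x => (u (x, r x)).1) η := hm'.fst
  have hb : AEStronglyMeasurable (fun x => (u (x, r x)).2) η := hm'.snd
  rw [coneMeasureProj_map_graph η hr]
  refine ⟨ha.mono_ac (withDensity_absolutelyContinuous _ _), ?_, ?_, ?_⟩
  · exact (hb.div₀ (by fun_prop)).mono_ac (withDensity_absolutelyContinuous _ _)
  all_goals
    rw [integrable_withDensity_iff_integrable_smul (by fun_prop)]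
    simp only [coneProjOp, NNReal.smul_def, Real.coe_toNNReal _ (sq_nonneg _), smul_eq_mul]
  · refine hi'.mono' (by fun_prop) (.of_forall fun x => ?_)
    rw [Real.norm_of_nonneg (by positivity)]
    exact le_add_of_nonneg_right (sq_nonneg _)
  · have h (x) : r x ^ 2 * ((u (x, r x)).2 / (2 * r x)) ^ 2 = (u (x, r x)).2 ^ 2 / 4 := by
      have := (hpos x).ne'
      field_simp
      norm_num
    simp only [h]
    refine hi'.mono' (by fun_prop) (.of_forall fun x => ?_)
    rw [Real.norm_of_nonneg (by positivity)]
    simp only [Function.comp_apply]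
    have : 0 ≤ r x ^ 2 * ‖(u (x, r x)).1‖ ^ 2 := by positivity
    linarith [sq_nonneg (u (x, r x)).2]

lemma coneLift_eq_of_eq {f g : Pair d} {x : EuclideanSpace ℝ (Fin d)} (s : ℝ)
    (h : f.1 x = g.1 x ∧ f.2 x = g.2 x) : coneLift f (x, s) = coneLift g (x, s) := by
  simp only [coneLift, h.1, h.2]

lemma coneLift_add (f g : Pair d) : coneLift (f + g) = coneLift f + coneLift g := by
  ext p : 1
  refine Prod.ext rfl ?_
  simp only [coneLift, Prod.snd_add, Pi.add_apply]
  ring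

lemma coneLift_smul (c : ℝ) (f : Pair d) : coneLift (c • f) = c • coneLift f := by
  ext p : 1
  refine Prod.ext rfl ?_
  simp only [coneLift, Prod.smul_snd, Pi.smul_apply, smul_eq_mul]
  ring

end Cone

end HKProjection

open HKProjection

/-- Along a bounded deterministic lift, the operator `Π^S = ℒ ∘ Π_μ ∘ 𝒫` on `H_λ` is linear,
idempotent, and self-adjoint; it maps into the lifted tangent space `ℒ(T_μ)`, annihilates its
orthogonal complement, and fixes (`λ`-a.e.) every element of the closure of `ℒ(T_μ)`.
Consequently `ℒ(T_μ)` is closed in `H_λ` and `Π^S` is the orthogonal projection onto it. -/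
theorem lifted_projection_is_orthogonal_projection {d : ℕ}
    (η : Measure (EuclideanSpace ℝ (Fin d))) [IsFiniteMeasure η]
    (r : EuclideanSpace ℝ (Fin d) → ℝ) (hrmeas : Measurable r) (hrpos : ∀ x, 0 < r x)
    (C : ℝ) (hrub : ∀ x, r x ≤ C) (hrlb : ∀ x, (r x)⁻¹ ≤ C)
    (lam : Measure (EuclideanSpace ℝ (Fin d) × ℝ))
    (hlam : lam = η.map fun x => (x, r x))
    (μ : Measure (EuclideanSpace ℝ (Fin d))) (hμ : μ = coneMeasureProj lam)
    (Pimu : (EuclideanSpace ℝ (Fin d) → EuclideanSpace ℝ (Fin d)) ×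
        (EuclideanSpace ℝ (Fin d) → ℝ) →
      (EuclideanSpace ℝ (Fin d) → EuclideanSpace ℝ (Fin d)) ×
        (EuclideanSpace ℝ (Fin d) → ℝ))
    -- `Π_μ` is the orthogonal projection of `H_μ` onto `T_μ`:
    (hPimem : ∀ f, memHμ μ f → memTμ μ (Pimu f))
    (hPiorth : ∀ f, memHμ μ f → ∀ φ : EuclideanSpace ℝ (Fin d) → ℝ,
      ContDiff ℝ (⊤ : ℕ∞) φ → HasCompactSupport φ →
      ∫ x, (⟪f.1 x - (Pimu f).1 x, gradient φ x⟫ +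
        4 * (f.2 x - (Pimu f).2 x) * φ x) ∂μ = 0) :
    -- (a) `Π^S` is linear (additive and homogeneous, `λ`-a.e.):
    (∀ u w, memHLam lam u → memHLam lam w →
      ∀ᵐ p ∂lam, coneLift (Pimu (coneProjOp r (u + w))) p =
        coneLift (Pimu (coneProjOp r u)) p + coneLift (Pimu (coneProjOp r w)) p) ∧
    (∀ (c : ℝ) (u), memHLam lam u →
      ∀ᵐ p ∂lam, coneLift (Pimu (coneProjOp r (c • u))) p =
        c • coneLift (Pimu (coneProjOp r u)) p) ∧
    -- (b) `Π^S` is idempotent: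
    (∀ u, memHLam lam u →
      ∀ᵐ p ∂lam, coneLift (Pimu (coneProjOp r (coneLift (Pimu (coneProjOp r u))))) p =
        coneLift (Pimu (coneProjOp r u)) p) ∧
    -- (c) `Π^S` is self-adjoint:
    (∀ u w, memHLam lam u → memHLam lam w →
      coneInner lam (coneLift (Pimu (coneProjOp r u))) w =
        coneInner lam u (coneLift (Pimu (coneProjOp r w)))) ∧
    -- (d) `Π^S u ∈ ℒ(T_μ)`:
    (∀ u, memHLam lam u → memTμ μ (Pimu (coneProjOp r u))) ∧
    -- (e) `u − Π^S u ⊥ ℒ(T_μ)`: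
    (∀ u, memHLam lam u → ∀ f, memTμ μ f →
      coneInner lam (fun p => u p - coneLift (Pimu (coneProjOp r u)) p) (coneLift f) = 0) ∧
    -- (f) `ℒ(T_μ)` is closed and `Π^S` fixes it: every `u ∈ H_λ` in the closure of
    -- `ℒ(T_μ)` satisfies `Π^S u = u` `λ`-a.e.
    (∀ u, memHLam lam u →
      (∀ ε > 0, ∃ f, memTμ μ f ∧
        coneInner lam (fun p => u p - coneLift f p) (fun p => u p - coneLift f p) < ε) →
      ∀ᵐ p ∂lam, coneLift (Pimu (coneProjOp r u)) p = u p) := by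
  have hfin : IsFiniteMeasure μ := by
    rw [hμ, hlam]
    exact isFiniteMeasure_coneMeasureProj hrmeas hrpos hrub
  have hH {u} (hu : memHLam lam u) : memHμ μ (coneProjOp r u) := by
    subst hμ hlam
    exact memHμ_coneProjOp hrmeas hrpos hu
  have hinner (u w) : coneInner lam u w = hkInner μ (coneProjOp r u) (coneProjOp r w) := by
    subst hμ hlam
    exact coneInner_map_graph hrmeas hrpos u w
  have hae {p : EuclideanSpace ℝ (Fin d) × ℝ → Prop} (h : ∀ᵐ x ∂μ, p (x, r x)) :
      ∀ᵐ q ∂lam, p q := by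
    subst hμ hlam
    exact (ae_map_graph_iff hrmeas hrpos).2 h
  have hPi {f : Pair d} (hf : memHμ μ f) :
      toHK (hPimem f hf).1 = (tangent μ).starProjection (toHK hf) :=
    toHK_eq_starProjection hf (hPimem f hf) (hPiorth f hf)
  refine ⟨fun u w hu hw => hae ?_, fun c u hu => hae ?_, fun u hu => hae ?_,
    fun u w hu hw => ?_, fun u hu => hPimem _ (hH hu), fun u hu f hf => ?_,
    fun u hu happ => hae ?_⟩
  · rw [coneProjOp_add]
    have hsum := memHμ_add (hH hu) (hH hw)
    have key : toHK (hPimem _ hsum).1 =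
        toHK (memHμ_add (hPimem _ (hH hu)).1 (hPimem _ (hH hw)).1) := by
      rw [toHK_add (hPimem _ (hH hu)).1 (hPimem _ (hH hw)).1, hPi hsum, hPi (hH hu), hPi (hH hw),
        toHK_add (hH hu) (hH hw), map_add]
    filter_upwards [(toHK_eq_iff _ _).1 key] with x hx
    rw [coneLift_eq_of_eq _ hx, coneLift_add, Pi.add_apply]
  · rw [coneProjOp_smul]
    have hsmul := memHμ_smul c (hH hu)
    have key : toHK (hPimem _ hsmul).1 = toHK (memHμ_smul c (hPimem _ (hH hu)).1) := by
      rw [toHK_smul c (hPimem _ (hH hu)).1, hPi hsmul, hPi (hH hu),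
        toHK_smul c (hH hu), map_smul]
    filter_upwards [(toHK_eq_iff _ _).1 key] with x hx
    rw [coneLift_eq_of_eq _ hx, coneLift_smul, Pi.smul_apply]
  · rw [coneProjOp_coneLift hrpos]
    have hT := hPimem _ (hH hu)
    have key : toHK (hPimem _ hT.1).1 = toHK hT.1 := by
      rw [hPi hT.1, Submodule.starProjection_eq_self_iff.2 (toHK_mem_tangent hT)]
    filter_upwards [(toHK_eq_iff _ _).1 key] with x hx
    exact coneLift_eq_of_eq _ hx
  · rw [hinner, hinner, coneProjOp_coneLift hrpos, coneProjOp_coneLift hrpos,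
      ← inner_toHK (hPimem _ (hH hu)).1 (hH hw), ← inner_toHK (hH hu) (hPimem _ (hH hw)).1,
      hPi (hH hu), hPi (hH hw), Submodule.inner_starProjection_left_eq_right]
  · have hT := hPimem _ (hH hu)
    change coneInner lam (u - coneLift (Pimu (coneProjOp r u))) (coneLift f) = 0
    rw [hinner, coneProjOp_sub, coneProjOp_coneLift hrpos, coneProjOp_coneLift hrpos,
      ← inner_toHK (memHμ_sub (hH hu) hT.1) hf.1, toHK_sub (hH hu) hT.1, hPi (hH hu)]
    exact Submodule.starProjection_inner_eq_zero _ _ (toHK_mem_tangent hf)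
  · have hmem : toHK (hH hu) ∈ tangent μ := by
      have hcl : IsClosed (tangent μ : Set (HKSpace μ)) :=
        Submodule.isClosed_topologicalClosure _
      rw [← SetLike.mem_coe, ← hcl.closure_eq]
      refine mem_closure_of_norm_sq_sub_lt fun ε hε => ?_
      obtain ⟨f, hf, hlt⟩ := happ ε hε
      refine ⟨_, toHK_mem_tangent hf, ?_⟩
      change coneInner lam (u - coneLift f) (u - coneLift f) < ε at hlt
      rwa [hinner, coneProjOp_sub, coneProjOp_coneLift hrpos,
        ← norm_sq_toHK_sub (hH hu) hf.1] at hlt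
    have key : toHK (hPimem _ (hH hu)).1 = toHK (hH hu) := by
      rw [hPi (hH hu), Submodule.starProjection_eq_self_iff.2 hmem]
    filter_upwards [(toHK_eq_iff _ _).1 key] with x hx
    rw [coneLift_eq_of_eq _ hx, coneLift_coneProjOp hrpos]

end
end

section
/- Let μ₀ be a finite measure on ℝ^d with compact support, let v : [0,1] × ℝ^d → ℝ^d and β : [0,1] × ℝ^d → ℝ be bounded continuous, and let X : [0,1] × ℝ^d → ℝ^d satisfy X(0,x) = x and ∂_t X(t,x) = v(t, X(t,x)) for all t ∈ [0,1] and all x in the support of μ₀. For t ∈ [0,1] define the finite measure ν_t on ℝ^d by ∫ f dν_t = ∫ f(X(t,x)) · exp(4 ∫₀ᵗ β(s, X(s,x)) ds) dμ₀(x) for bounded measurable f. Then (ν_t) is a distributional solution of the continuity–reaction equation: for every continuously differentiable ψ with compact support in (0,1) × ℝ^d, ∫₀¹ ∫ ( ∂_t ψ(t,y) + ⟨∇_y ψ(t,y), v(t,y)⟩ + 4 β(t,y) ψ(t,y) ) dν_t(y) dt = 0. -/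
open Real MeasureTheory
open scoped RealInnerProductSpace ENNReal

noncomputable section

/-- The measure `ν_t` determined by
`∫ f dν_t = ∫ f(X(t,x)) exp(4∫₀ᵗ β(s,X(s,x)) ds) dμ₀(x)`. -/
def reactionFlowMeasure {d : ℕ} (μ₀ : Measure (EuclideanSpace ℝ (Fin d)))
    (X : ℝ → EuclideanSpace ℝ (Fin d) → EuclideanSpace ℝ (Fin d))
    (β : ℝ → EuclideanSpace ℝ (Fin d) → ℝ) (t : ℝ) :
    Measure (EuclideanSpace ℝ (Fin d)) :=
  (μ₀.withDensity fun x =>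
    ENNReal.ofReal (Real.exp (4 * ∫ s in (0 : ℝ)..t, β s (X s x)))).map (X t)

lemma continuous_comp_curve {E : Type*} [TopologicalSpace E] {β : ℝ → E → ℝ}
    (hβ : Continuous fun q : ℝ × E => β q.1 q.2) {γ : ℝ → E} (hγ : Continuous γ) :
    Continuous fun s => β s (γ s) :=
  hβ.comp (continuous_id.prodMk hγ)

/-- The reaction weight along a family of continuous curves is jointly measurable. -/
lemma measurable_reactionWeight {E : Type*} [TopologicalSpace E] [MeasurableSpace E]
    [BorelSpace E] [SecondCountableTopology E] [TopologicalSpace.PseudoMetrizableSpace E]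
    {β : ℝ → E → ℝ} (hβ : Continuous fun q : ℝ × E => β q.1 q.2) {Y : ℝ → E → E}
    (hYm : ∀ t, Measurable (Y t)) (hYc : ∀ x, Continuous fun t => Y t x) :
    Measurable fun q : ℝ × E => Real.exp (4 * ∫ s in (0 : ℝ)..q.1, β s (Y s q.2)) := by
  have hY : Measurable fun q : ℝ × E => Y q.1 q.2 :=
    measurable_uncurry_of_continuous_of_measurable hYc hYm
  have hβY : Measurable fun q : ℝ × E => β q.1 (Y q.1 q.2) :=
    hβ.measurable.comp (measurable_fst.prodMk hY)
  have hint : ∀ t, Measurable fun x => ∫ s in (0 : ℝ)..t, β s (Y s x) := by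
    intro t
    have hsw : StronglyMeasurable fun q : E × ℝ => β q.2 (Y q.2 q.1) :=
      (hβY.comp measurable_swap).stronglyMeasurable
    simp only [intervalIntegral]
    exact (hsw.integral_prod_right (ν := volume.restrict (Set.Ioc 0 t))).measurable.sub
      (hsw.integral_prod_right (ν := volume.restrict (Set.Ioc t 0))).measurable
  have hunc : Measurable fun q : ℝ × E => ∫ s in (0 : ℝ)..q.1, β s (Y s q.2) :=
    measurable_uncurry_of_continuous_of_measurable
      (u := fun t x => ∫ s in (0 : ℝ)..t, β s (Y s x))
      (fun x => intervalIntegral.continuous_primitive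
        (fun a b => (continuous_comp_curve hβ (hYc x)).intervalIntegrable a b) 0) hint
  exact Real.measurable_exp.comp (hunc.const_mul 4)

/-- The reaction measures only depend on the curves starting at almost every point. -/
lemma reactionFlowMeasure_congr {d : ℕ} {μ₀ : Measure (EuclideanSpace ℝ (Fin d))}
    {X Y : ℝ → EuclideanSpace ℝ (Fin d) → EuclideanSpace ℝ (Fin d)}
    {β : ℝ → EuclideanSpace ℝ (Fin d) → ℝ}
    (h : ∀ᵐ x ∂μ₀, ∀ t ∈ Set.Icc (0 : ℝ) 1, X t x = Y t x)
    {t : ℝ} (ht : t ∈ Set.Icc (0 : ℝ) 1) :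
    reactionFlowMeasure μ₀ X β t = reactionFlowMeasure μ₀ Y β t := by
  unfold reactionFlowMeasure
  have hd : (fun x => ENNReal.ofReal (Real.exp (4 * ∫ s in (0 : ℝ)..t, β s (X s x))))
      =ᵐ[μ₀] fun x => ENNReal.ofReal (Real.exp (4 * ∫ s in (0 : ℝ)..t, β s (Y s x))) := by
    filter_upwards [h] with x hx
    congr 3
    refine intervalIntegral.integral_congr fun s hs => ?_
    rw [Set.uIcc_of_le ht.1] at hs
    simp only [hx s ⟨hs.1, hs.2.trans ht.2⟩]
  rw [withDensity_congr_ae hd]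
  refine Measure.map_congr ((withDensity_absolutelyContinuous μ₀ _).ae_le ?_)
  filter_upwards [h] with x hx using hx t ht

lemma integral_reactionFlowMeasure {d : ℕ} {μ₀ : Measure (EuclideanSpace ℝ (Fin d))}
    {Y : ℝ → EuclideanSpace ℝ (Fin d) → EuclideanSpace ℝ (Fin d)}
    {β : ℝ → EuclideanSpace ℝ (Fin d) → ℝ}
    (hβ : Continuous fun q : ℝ × EuclideanSpace ℝ (Fin d) => β q.1 q.2)
    (hYm : ∀ t, Measurable (Y t)) (hYc : ∀ x, Continuous fun t => Y t x) (t : ℝ)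
    {f : EuclideanSpace ℝ (Fin d) → ℝ} (hf : Continuous f) :
    ∫ y, f y ∂(reactionFlowMeasure μ₀ Y β t) =
      ∫ x, Real.exp (4 * ∫ s in (0 : ℝ)..t, β s (Y s x)) * f (Y t x) ∂μ₀ := by
  have hw : Measurable fun x => Real.exp (4 * ∫ s in (0 : ℝ)..t, β s (Y s x)) :=
    (measurable_reactionWeight hβ hYm hYc).comp measurable_prodMk_left
  rw [reactionFlowMeasure, integral_map (hYm t).aemeasurable hf.aestronglyMeasurable,
    integral_withDensity_eq_integral_toReal_smul hw.ennreal_ofReal (by simp)]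
  simp [ENNReal.toReal_ofReal (Real.exp_pos _).le]

/-- The test-function integrand is the derivative of `ψ` in the direction `(1, v)`, plus the
reaction term. -/
lemma deriv_add_inner_gradient_eq_fderiv {E : Type*} [NormedAddCommGroup E]
    [InnerProductSpace ℝ E] [CompleteSpace E] {ψ : ℝ × E → ℝ} {t : ℝ} {y : E}
    (hψ : DifferentiableAt ℝ ψ (t, y)) (w : E) :
    deriv (fun s => ψ (s, y)) t + ⟪gradient (fun z => ψ (t, z)) y, w⟫ =
      fderiv ℝ ψ (t, y) (1, w) := by
  have h1 : HasDerivAt (fun s => ψ (s, y)) (fderiv ℝ ψ (t, y) (1, 0)) t :=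
    hψ.hasFDerivAt.comp_hasDerivAt t ((hasDerivAt_id t).prodMk (hasDerivAt_const t y))
  have h2 : HasFDerivAt (fun z => ψ (t, z))
      ((fderiv ℝ ψ (t, y)).comp (ContinuousLinearMap.inr ℝ ℝ E)) y :=
    hψ.hasFDerivAt.comp y (hasFDerivAt_prodMk_right t y)
  rw [h1.deriv, gradient, InnerProductSpace.toDual_symm_apply, h2.fderiv,
    ContinuousLinearMap.comp_apply, ContinuousLinearMap.inr_apply, ← map_add]
  simp

/-- Along a single integral curve, the weighted test function integrates to zero. -/
lemma integral_reaction_along_curve {E : Type*} [NormedAddCommGroup E] [NormedSpace ℝ E]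
    {v : ℝ → E → E} {β : ℝ → E → ℝ}
    (hv : Continuous fun q : ℝ × E => v q.1 q.2) (hβ : Continuous fun q : ℝ × E => β q.1 q.2)
    {ψ : ℝ × E → ℝ} (hψ : ContDiff ℝ 1 ψ)
    (hψsupp : tsupport ψ ⊆ Set.Ioo (0 : ℝ) 1 ×ˢ Set.univ)
    {γ : ℝ → E} (hγ : Continuous γ)
    (hode : ∀ t ∈ Set.Ioo (0 : ℝ) 1, HasDerivAt γ (v t (γ t)) t) :
    ∫ t in (0 : ℝ)..1, Real.exp (4 * ∫ s in (0 : ℝ)..t, β s (γ s)) *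
      (fderiv ℝ ψ (t, γ t) (1, v t (γ t)) + 4 * β t (γ t) * ψ (t, γ t)) = 0 := by
  have hβγ : Continuous fun s => β s (γ s) := continuous_comp_curve hβ hγ
  have hvγ : Continuous fun s => v s (γ s) := hv.comp (continuous_id.prodMk hγ)
  have hw : ∀ t, HasDerivAt (fun t => Real.exp (4 * ∫ s in (0 : ℝ)..t, β s (γ s)))
      (Real.exp (4 * ∫ s in (0 : ℝ)..t, β s (γ s)) * (4 * β t (γ t))) t := fun t =>
    ((hβγ.integral_hasStrictDerivAt 0 t).hasDerivAt.const_mul 4).exp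
  have hwc : Continuous fun t => Real.exp (4 * ∫ s in (0 : ℝ)..t, β s (γ s)) :=
    continuous_iff_continuousAt.2 fun t => (hw t).continuousAt
  have hψγ : Continuous fun t => ψ (t, γ t) := hψ.continuous.comp (continuous_id.prodMk hγ)
  have hdψ : Continuous fun t => fderiv ℝ ψ (t, γ t) (1, v t (γ t)) :=
    ((hψ.continuous_fderiv one_ne_zero).comp (continuous_id.prodMk hγ)).clm_apply
      (continuous_const.prodMk hvγ)
  have hzero : ∀ t ∉ Set.Ioo (0 : ℝ) 1, ψ (t, γ t) = 0 := fun t ht =>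
    image_eq_zero_of_notMem_tsupport fun h => ht (hψsupp h).1
  rw [intervalIntegral.integral_eq_sub_of_hasDerivAt_of_le zero_le_one
    (hwc.mul hψγ).continuousOn (fun t ht => ?_)
    (Continuous.intervalIntegrable (by fun_prop) _ _)]
  · simp [hzero]
  · have hcomp : HasDerivAt (fun t => ψ (t, γ t)) (fderiv ℝ ψ (t, γ t) (1, v t (γ t))) t :=
      ((hψ.differentiable one_ne_zero) (t, γ t)).hasFDerivAt.comp_hasDerivAt t
        ((hasDerivAt_id t).prodMk (hode t ht))
    refine ((hw t).mul hcomp).congr_deriv ?_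
    ring

/-- The continuity–reaction equation for a family of curves which are continuous in time and
measurable in the starting point everywhere, and integral curves almost everywhere. -/
lemma integral_reactionFlowMeasure_eq_zero {d : ℕ}
    {μ₀ : Measure (EuclideanSpace ℝ (Fin d))} [IsFiniteMeasure μ₀]
    {v : ℝ → EuclideanSpace ℝ (Fin d) → EuclideanSpace ℝ (Fin d)}
    {β : ℝ → EuclideanSpace ℝ (Fin d) → ℝ}
    (hv : Continuous fun q : ℝ × EuclideanSpace ℝ (Fin d) => v q.1 q.2)
    (hβ : Continuous fun q : ℝ × EuclideanSpace ℝ (Fin d) => β q.1 q.2)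
    {Mβ : ℝ} (hβb : ∀ t x, |β t x| ≤ Mβ)
    {Y : ℝ → EuclideanSpace ℝ (Fin d) → EuclideanSpace ℝ (Fin d)}
    (hYm : ∀ t, Measurable (Y t)) (hYc : ∀ x, Continuous fun t => Y t x)
    (hYode : ∀ᵐ x ∂μ₀, ∀ t ∈ Set.Ioo (0 : ℝ) 1,
      HasDerivAt (fun s => Y s x) (v t (Y t x)) t)
    {ψ : ℝ × EuclideanSpace ℝ (Fin d) → ℝ} (hψ : ContDiff ℝ 1 ψ)
    (hψc : HasCompactSupport ψ)
    (hψsupp : tsupport ψ ⊆ Set.Ioo (0 : ℝ) 1 ×ˢ Set.univ) :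
    ∫ t in (0 : ℝ)..1, ∫ y, (fderiv ℝ ψ (t, y) (1, v t y) + 4 * β t y * ψ (t, y))
      ∂(reactionFlowMeasure μ₀ Y β t) = 0 := by
  set G : ℝ × EuclideanSpace ℝ (Fin d) → ℝ := fun q =>
    fderiv ℝ ψ q (1, v q.1 q.2) + 4 * β q.1 q.2 * ψ q with hG
  have hGc : Continuous G :=
    ((hψ.continuous_fderiv one_ne_zero).clm_apply (continuous_const.prodMk hv)).add
      ((continuous_const.mul hβ).mul hψ.continuous)
  have hGs : HasCompactSupport G := by
    refine HasCompactSupport.add ?_ hψc.mul_left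
    exact (hψc.fderiv ℝ).mono fun q hq h0 => hq (by simp [h0])
  obtain ⟨C, hC⟩ := hGc.bounded_above_of_compact_support hGs
  have hYu : Measurable fun q : ℝ × EuclideanSpace ℝ (Fin d) => Y q.1 q.2 :=
    measurable_uncurry_of_continuous_of_measurable hYc hYm
  have hmeas : Measurable fun q : ℝ × EuclideanSpace ℝ (Fin d) =>
      Real.exp (4 * ∫ s in (0 : ℝ)..q.1, β s (Y s q.2)) * G (q.1, Y q.1 q.2) :=
    (measurable_reactionWeight hβ hYm hYc).mul
      (hGc.measurable.comp (measurable_fst.prodMk hYu))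
  have hbound : ∀ t ∈ Set.Ioc (0 : ℝ) 1, ∀ x,
      ‖Real.exp (4 * ∫ s in (0 : ℝ)..t, β s (Y s x)) * G (t, Y t x)‖ ≤
        Real.exp (4 * Mβ) * C := by
    intro t ht x
    have hM : 0 ≤ Mβ := (abs_nonneg _).trans (hβb 0 0)
    have h1 : ∫ s in (0 : ℝ)..t, β s (Y s x) ≤ Mβ := by
      have h2 := intervalIntegral.norm_integral_le_of_norm_le_const (a := 0) (b := t)
        (f := fun s => β s (Y s x)) (C := Mβ) fun s _ => hβb s (Y s x)
      rw [sub_zero, abs_of_pos ht.1, Real.norm_eq_abs] at h2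
      exact (le_abs_self _).trans (h2.trans (mul_le_of_le_one_right hM ht.2))
    rw [norm_mul, Real.norm_eq_abs, Real.abs_exp]
    gcongr
    exact hC _
  have hint : Integrable (Function.uncurry fun t x =>
      Real.exp (4 * ∫ s in (0 : ℝ)..t, β s (Y s x)) * G (t, Y t x))
      ((volume.restrict (Set.uIoc (0 : ℝ) 1)).prod μ₀) := by
    rw [Set.uIoc_of_le zero_le_one]
    refine Integrable.of_bound hmeas.aestronglyMeasurable (Real.exp (4 * Mβ) * C) ?_
    have h : ∀ᵐ q ∂((volume.restrict (Set.Ioc (0 : ℝ) 1)).prod μ₀),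
        q.1 ∈ Set.Ioc (0 : ℝ) 1 :=
      Measure.quasiMeasurePreserving_fst.ae (ae_restrict_mem measurableSet_Ioc)
    filter_upwards [h] with q hq using hbound q.1 hq q.2
  calc ∫ t in (0 : ℝ)..1, ∫ y, G (t, y) ∂(reactionFlowMeasure μ₀ Y β t)
      = ∫ t in (0 : ℝ)..1, ∫ x,
          Real.exp (4 * ∫ s in (0 : ℝ)..t, β s (Y s x)) * G (t, Y t x) ∂μ₀ :=
        intervalIntegral.integral_congr fun t _ =>
          integral_reactionFlowMeasure hβ hYm hYc t (hGc.comp (Continuous.prodMk_right t))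
    _ = ∫ x, (∫ t in (0 : ℝ)..1,
          Real.exp (4 * ∫ s in (0 : ℝ)..t, β s (Y s x)) * G (t, Y t x)) ∂μ₀ :=
        intervalIntegral_integral_swap hint
    _ = 0 := by
        refine integral_eq_zero_of_ae ?_
        filter_upwards [hYode] with x hx
        exact integral_reaction_along_curve hv hβ hψ hψsupp (hYc x) hx

/-- If `X` is the flow of the bounded continuous velocity field `v` on the (compact) support
of `μ₀`, then the curve of measures `ν_t = (X_t)_#(exp(4∫₀ᵗ β(s,X_s)) μ₀)` is a distributional
solution of the continuity–reaction equation `∂_t ν_t + ∇·(ν_t v_t) = 4 β_t ν_t` on `(0,1)`: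
for every `C¹` test function `ψ` compactly supported in `(0,1) × ℝ^d`,
`∫₀¹ ∫ (∂_tψ + ⟨∇ψ, v⟩ + 4βψ) dν_t dt = 0`. -/
theorem continuity_reaction_distributional_solution {d : ℕ}
    (μ₀ : Measure (EuclideanSpace ℝ (Fin d))) [IsFiniteMeasure μ₀]
    (K : Set (EuclideanSpace ℝ (Fin d))) (hK : IsCompact K) (hKsupp : μ₀ Kᶜ = 0)
    (v : ℝ → EuclideanSpace ℝ (Fin d) → EuclideanSpace ℝ (Fin d))
    (β : ℝ → EuclideanSpace ℝ (Fin d) → ℝ)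
    (hv : Continuous fun q : ℝ × EuclideanSpace ℝ (Fin d) => v q.1 q.2)
    (hβ : Continuous fun q : ℝ × EuclideanSpace ℝ (Fin d) => β q.1 q.2)
    (Mv : ℝ) (hvb : ∀ t x, ‖v t x‖ ≤ Mv)
    (Mβ : ℝ) (hβb : ∀ t x, |β t x| ≤ Mβ)
    (X : ℝ → EuclideanSpace ℝ (Fin d) → EuclideanSpace ℝ (Fin d))
    (hXmeas : ∀ t, Measurable (X t))
    (hX0 : ∀ x, X 0 x = x)
    (hXode : ∀ x ∈ K, ∀ t ∈ Set.Icc (0 : ℝ) 1,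
      HasDerivAt (fun s => X s x) (v t (X t x)) t)
    (ψ : ℝ × EuclideanSpace ℝ (Fin d) → ℝ) (hψ : ContDiff ℝ 1 ψ)
    (hψc : HasCompactSupport ψ)
    (hψsupp : tsupport ψ ⊆ Set.Ioo (0 : ℝ) 1 ×ˢ Set.univ) :
    ∫ t in (0 : ℝ)..1, ∫ y,
        (deriv (fun s => ψ (s, y)) t +
          ⟪gradient (fun z => ψ (t, z)) y, v t y⟫ +
          4 * β t y * ψ (t, y)) ∂(reactionFlowMeasure μ₀ X β t) = 0 := by
  classical
  set Y : ℝ → EuclideanSpace ℝ (Fin d) → EuclideanSpace ℝ (Fin d) := fun t =>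
    K.piecewise (X (Set.projIcc 0 1 zero_le_one t)) id with hY
  have hYK : ∀ x ∈ K, ∀ t ∈ Set.Icc (0 : ℝ) 1, X t x = Y t x := by
    intro x hx t ht
    simp [hY, hx, Set.projIcc_of_mem zero_le_one ht]
  have hYm : ∀ t, Measurable (Y t) := fun t =>
    (hXmeas _).piecewise hK.measurableSet measurable_id
  have hYc : ∀ x, Continuous fun t => Y t x := by
    intro x
    by_cases hx : x ∈ K
    · have hXc : ContinuousOn (fun s => X s x) (Set.Icc 0 1) := fun t ht =>
        (hXode x hx t ht).continuousAt.continuousWithinAt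
      simpa [hY, hx, Set.IccExtend, Function.comp_def] using
        hXc.domRestrict.Icc_extend' (h := zero_le_one)
    · simpa [hY, hx] using continuous_const
  have hYode : ∀ x ∈ K, ∀ t ∈ Set.Ioo (0 : ℝ) 1,
      HasDerivAt (fun s => Y s x) (v t (Y t x)) t := by
    intro x hx t ht
    have hmem := Set.Ioo_subset_Icc_self ht
    rw [← hYK x hx t hmem]
    refine (hXode x hx t hmem).congr_of_eventuallyEq ?_
    filter_upwards [Ioo_mem_nhds ht.1 ht.2] with s hs
    exact (hYK x hx s (Set.Ioo_subset_Icc_self hs)).symm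
  have hKae : ∀ᵐ x ∂μ₀, x ∈ K := hKsupp
  refine (intervalIntegral.integral_congr fun t ht => ?_).trans
    (integral_reactionFlowMeasure_eq_zero hv hβ hβb hYm hYc (hKae.mono hYode) hψ hψc hψsupp)
  rw [Set.uIcc_of_le zero_le_one] at ht
  simp only [reactionFlowMeasure_congr (β := β) (hKae.mono hYK) ht]
  congr 1 with y
  rw [deriv_add_inner_gradient_eq_fderiv (hψ.differentiable one_ne_zero (t, y))]

end
end

section
/- Let μ₀ be a finite measure on ℝ^d with compact support, let v : [0,1] × ℝ^d → ℝ^d and β : [0,1] × ℝ^d → ℝ be bounded continuous, and let X : [0,1] × ℝ^d → ℝ^d satisfy X(0,x) = x and ∂_t X(t,x) = v(t, X(t,x)) for all t ∈ [0,1] and all x in the support of μ₀. Define r(t,x) = exp(2 ∫₀ᵗ β(s, X(s,x)) ds), F_t(x) = (X(t,x), r(t,x)) ∈ ℝ^d × (0,∞), λ_t = (F_t)_#μ₀, and the cone vector field V_t(x,ρ) = (v(t,x), 2β(t,x)ρ). Then (λ_t, V_t) solves the continuity equation on the cone in the distributional sense: for every continuously differentiable Ψ with compact support in (0,1) × ℝ^d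 × (0,∞), ∫₀¹ ∫ ( ∂_tΨ(t,x,ρ) + ⟨∇_xΨ(t,x,ρ), v(t,x)⟩ + ∂_ρΨ(t,x,ρ) · 2β(t,x)ρ ) dλ_t(x,ρ) dt = 0. -/
open Real MeasureTheory
open scoped RealInnerProductSpace ENNReal

noncomputable section

/-- The lifted flow measure `λ_t = (F_t)_#μ₀` with `F_t(x) = (X(t,x), r(t,x))`. -/
def liftedFlowMeasure {d : ℕ} (μ₀ : Measure (EuclideanSpace ℝ (Fin d)))
    (X : ℝ → EuclideanSpace ℝ (Fin d) → EuclideanSpace ℝ (Fin d))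
    (rf : ℝ → EuclideanSpace ℝ (Fin d) → ℝ) (t : ℝ) :
    Measure (EuclideanSpace ℝ (Fin d) × ℝ) :=
  μ₀.map fun x => (X t x, rf t x)

/-- The derivative of `Ψ` at `(t, (x, ρ))` in the direction `(1, (w, c))` is the sum of the three
partial contributions. -/
theorem partial_derivs_eq_fderiv {E : Type*} [NormedAddCommGroup E] [InnerProductSpace ℝ E]
    [CompleteSpace E] {Ψ : ℝ × (E × ℝ) → ℝ} {t : ℝ} {p : E × ℝ}
    (hΨ : DifferentiableAt ℝ Ψ (t, p)) (w : E) (c : ℝ) :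
    deriv (fun s => Ψ (s, p)) t + ⟪gradient (fun y => Ψ (t, (y, p.2))) p.1, w⟫ +
      deriv (fun ρ => Ψ (t, (p.1, ρ))) p.2 * c = fderiv ℝ Ψ (t, p) (1, (w, c)) := by
  have h := hΨ.hasFDerivAt
  have h₁ : HasDerivAt (fun s => Ψ (s, p)) (fderiv ℝ Ψ (t, p) (1, 0)) t :=
    HasFDerivAt.comp_hasDerivAt (f := fun s : ℝ => (s, p)) t h
      ((hasDerivAt_id t).prodMk (hasDerivAt_const t p))
  have h₂ : HasFDerivAt (fun y => Ψ (t, (y, p.2)))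
      ((fderiv ℝ Ψ (t, p)).comp
        ((0 : E →L[ℝ] ℝ).prod ((ContinuousLinearMap.id ℝ E).prod (0 : E →L[ℝ] ℝ)))) p.1 :=
    HasFDerivAt.comp (f := fun y : E => (t, (y, p.2))) p.1 h
      ((hasFDerivAt_const t p.1).prodMk ((hasFDerivAt_id p.1).prodMk (hasFDerivAt_const p.2 p.1)))
  have h₃ : HasDerivAt (fun ρ => Ψ (t, (p.1, ρ))) (fderiv ℝ Ψ (t, p) (0, (0, 1))) p.2 :=
    HasFDerivAt.comp_hasDerivAt (f := fun ρ : ℝ => (t, (p.1, ρ))) p.2 h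
      ((hasDerivAt_const p.2 t).prodMk ((hasDerivAt_const p.2 p.1).prodMk (hasDerivAt_id p.2)))
  rw [h₁.deriv, h₃.deriv, gradient, InnerProductSpace.toDual_symm_apply, h₂.fderiv]
  have hsplit : ((1, (w, c)) : ℝ × (E × ℝ)) = (1, 0) + (0, (w, 0)) + c • (0, (0, 1)) := by
    simp
  rw [hsplit, map_add, map_add, map_smul, smul_eq_mul, mul_comm c]
  simp

/-- The lifted curve `λ_t = (X_t, r_t)_#μ₀`, with `r(t,x) = exp(2∫₀ᵗ β(s,X(s,x)) ds)`,
together with the lifted field `V_t(x,ρ) = (v(t,x), 2β(t,x)ρ)`, solves the continuity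
equation on the cone in the distributional sense: for every `C¹` test function `Ψ` compactly
supported in `(0,1) × ℝ^d × (0,∞)`,
`∫₀¹ ∫ (∂_tΨ + ⟨∇_xΨ, v⟩ + ∂_ρΨ · 2βρ) dλ_t dt = 0`. -/
theorem lifted_flow_solves_cone_continuity_equation {d : ℕ}
    (μ₀ : Measure (EuclideanSpace ℝ (Fin d))) [IsFiniteMeasure μ₀]
    (K : Set (EuclideanSpace ℝ (Fin d))) (hK : IsCompact K) (hKsupp : μ₀ Kᶜ = 0)
    (v : ℝ → EuclideanSpace ℝ (Fin d) → EuclideanSpace ℝ (Fin d))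
    (β : ℝ → EuclideanSpace ℝ (Fin d) → ℝ)
    (hv : Continuous fun q : ℝ × EuclideanSpace ℝ (Fin d) => v q.1 q.2)
    (hβ : Continuous fun q : ℝ × EuclideanSpace ℝ (Fin d) => β q.1 q.2)
    (Mv : ℝ) (hvb : ∀ t x, ‖v t x‖ ≤ Mv)
    (Mβ : ℝ) (hβb : ∀ t x, |β t x| ≤ Mβ)
    (X : ℝ → EuclideanSpace ℝ (Fin d) → EuclideanSpace ℝ (Fin d))
    (hXmeas : ∀ t, Measurable (X t))
    (hX0 : ∀ x, X 0 x = x)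
    (hXode : ∀ x ∈ K, ∀ t ∈ Set.Icc (0 : ℝ) 1,
      HasDerivAt (fun s => X s x) (v t (X t x)) t)
    (rf : ℝ → EuclideanSpace ℝ (Fin d) → ℝ)
    (hrf : ∀ t x, rf t x = Real.exp (2 * ∫ s in (0 : ℝ)..t, β s (X s x)))
    (Ψ : ℝ × (EuclideanSpace ℝ (Fin d) × ℝ) → ℝ) (hΨ : ContDiff ℝ 1 Ψ)
    (hΨc : HasCompactSupport Ψ)
    (hΨsupp : tsupport Ψ ⊆ Set.Ioo (0 : ℝ) 1 ×ˢ (Set.univ ×ˢ Set.Ioi (0 : ℝ))) :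
    ∫ t in (0 : ℝ)..1, ∫ p,
        (deriv (fun s => Ψ (s, p)) t +
          ⟪gradient (fun y => Ψ (t, (y, p.2))) p.1, v t p.1⟫ +
          deriv (fun ρ => Ψ (t, (p.1, ρ))) p.2 * (2 * β t p.1 * p.2))
        ∂(liftedFlowMeasure μ₀ X rf t) = 0 := by
  have hKm : MeasurableSet K := hK.measurableSet
  have hKae : ∀ᵐ x ∂μ₀, x ∈ K := hKsupp
  -- the flow, frozen outside `[0, 1]` and set to zero off `K`
  let Y : ℝ → EuclideanSpace ℝ (Fin d) → EuclideanSpace ℝ (Fin d) :=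
    fun t => K.indicator (X (Set.projIcc (0 : ℝ) 1 zero_le_one t))
  have hYX : ∀ t ∈ Set.Icc (0 : ℝ) 1, ∀ x ∈ K, Y t x = X t x := fun t ht x hx => by
    simp only [Y, Set.indicator_of_mem hx, Set.projIcc_of_mem zero_le_one ht]
  have hYcont : ∀ x, Continuous fun t => Y t x := fun x => by
    by_cases hx : x ∈ K
    · simp only [Y, Set.indicator_of_mem hx]
      have hXc : ContinuousOn (fun s => X s x) (Set.Icc 0 1) := fun s hs =>
        (hXode x hx s hs).continuousAt.continuousWithinAt
      exact hXc.domRestrict.comp continuous_projIcc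
    · simp only [Y, Set.indicator_of_notMem hx]
      exact continuous_const
  have hYmeas : ∀ t, Measurable (Y t) := fun t => (hXmeas _).indicator hKm
  have hYjoint : Measurable fun q : ℝ × EuclideanSpace ℝ (Fin d) => Y q.1 q.2 :=
    measurable_uncurry_of_continuous_of_measurable hYcont hYmeas
  have hβY : ∀ x, Continuous fun s => β s (Y s x) := fun x =>
    hβ.comp (continuous_id.prodMk (hYcont x))
  let R : ℝ → EuclideanSpace ℝ (Fin d) → ℝ := fun t x => Real.exp (2 * ∫ s in (0 : ℝ)..t, β s (Y s x))
  have hRderiv : ∀ x t, HasDerivAt (fun s => R s x) (2 * β t (Y t x) * R t x) t := fun x t => by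
    have h := (((hβY x).integral_hasStrictDerivAt 0 t).hasDerivAt.const_mul 2).exp
    convert h using 1
    simp only [R]
    ring
  have hRcont : ∀ x, Continuous fun t => R t x := fun x =>
    continuous_iff_continuousAt.2 fun t => (hRderiv x t).continuousAt
  have hRmeas : ∀ t, Measurable (R t) := fun t => by
    have hsm : StronglyMeasurable fun q : EuclideanSpace ℝ (Fin d) × ℝ => β q.2 (Y q.2 q.1) :=
      (hβ.measurable.comp (measurable_snd.prodMk
        (hYjoint.comp measurable_swap))).stronglyMeasurable
    simp only [R, intervalIntegral]
    exact ((hsm.integral_prod_right'.measurable.sub hsm.integral_prod_right'.measurable).const_mul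
      2).exp
  have hRrf : ∀ t ∈ Set.Icc (0 : ℝ) 1, ∀ x ∈ K, R t x = rf t x := fun t ht x hx => by
    rw [hrf]
    simp only [R]
    congr 2
    refine intervalIntegral.integral_congr fun s hs => ?_
    rw [Set.uIcc_of_le ht.1] at hs
    simp only [hYX s ⟨hs.1, hs.2.trans ht.2⟩ x hx]
  have hRjoint : Measurable fun q : ℝ × EuclideanSpace ℝ (Fin d) => R q.1 q.2 :=
    measurable_uncurry_of_continuous_of_measurable hRcont hRmeas
  -- the derivative of `Ψ` along the lifted field
  let G : ℝ × (EuclideanSpace ℝ (Fin d) × ℝ) → ℝ := fun q =>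
    fderiv ℝ Ψ q (1, (v q.1 q.2.1, 2 * β q.1 q.2.1 * q.2.2))
  have hGcont : Continuous G := by
    have hv' : Continuous fun q : ℝ × (EuclideanSpace ℝ (Fin d) × ℝ) => v q.1 q.2.1 :=
      hv.comp (continuous_fst.prodMk (continuous_fst.comp continuous_snd))
    have hβ' : Continuous fun q : ℝ × (EuclideanSpace ℝ (Fin d) × ℝ) => β q.1 q.2.1 :=
      hβ.comp (continuous_fst.prodMk (continuous_fst.comp continuous_snd))
    exact (hΨ.continuous_fderiv one_ne_zero).clm_apply (by fun_prop)
  obtain ⟨C, hC⟩ : ∃ C, ∀ q, ‖G q‖ ≤ C := by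
    have hGc : HasCompactSupport G := (hΨc.fderiv ℝ).mono fun q hq hq0 => hq (by simp [G, hq0])
    exact hGc.exists_bound_of_continuous hGcont
  have hpush : ∀ t ∈ Set.Icc (0 : ℝ) 1,
      ∫ p, (deriv (fun s => Ψ (s, p)) t +
          ⟪gradient (fun y => Ψ (t, (y, p.2))) p.1, v t p.1⟫ +
          deriv (fun ρ => Ψ (t, (p.1, ρ))) p.2 * (2 * β t p.1 * p.2))
        ∂(liftedFlowMeasure μ₀ X rf t) = ∫ x, G (t, (Y t x, R t x)) ∂μ₀ := fun t ht => by
    have hmap : liftedFlowMeasure μ₀ X rf t = μ₀.map fun x => (Y t x, R t x) :=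
      Measure.map_congr (hKae.mono fun x hx => by simp only [hYX t ht x hx, hRrf t ht x hx])
    simp only [partial_derivs_eq_fderiv (hΨ.differentiable one_ne_zero _)]
    rw [hmap]
    exact integral_map ((hYmeas t).prodMk (hRmeas t)).aemeasurable
      (hGcont.comp (continuous_const.prodMk continuous_id)).aestronglyMeasurable
  have hinner : ∀ x ∈ K, ∫ t in (0 : ℝ)..1, G (t, (Y t x, R t x)) = 0 := fun x hx => by
    have hcurve : Continuous fun t : ℝ => (t, (Y t x, R t x)) :=
      continuous_id.prodMk ((hYcont x).prodMk (hRcont x))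
    have hvanish : ∀ t : ℝ, t ∉ Set.Ioo (0 : ℝ) 1 → ∀ p, Ψ (t, p) = 0 := fun t ht p =>
      image_eq_zero_of_notMem_tsupport fun h => ht (Set.mem_prod.1 (hΨsupp h)).1
    rw [intervalIntegral.integral_eq_sub_of_hasDerivAt_of_le zero_le_one
      (f := fun t => Ψ (t, (Y t x, R t x)))
      (f' := fun t => G (t, (Y t x, R t x))) (hΨ.continuous.comp hcurve).continuousOn
      (fun t ht => ?_) ((hGcont.comp hcurve).intervalIntegrable 0 1)]
    · rw [hvanish 1 (by simp), hvanish 0 (by simp), sub_zero]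
    · have htI := Set.Ioo_subset_Icc_self ht
      have hY : HasDerivAt (fun s => Y s x) (v t (Y t x)) t := by
        rw [hYX t htI x hx]
        refine (hXode x hx t htI).congr_of_eventuallyEq ?_
        filter_upwards [Ioo_mem_nhds ht.1 ht.2] with s hs
        exact hYX s (Set.Ioo_subset_Icc_self hs) x hx
      exact HasFDerivAt.comp_hasDerivAt (f := fun s : ℝ => (s, (Y s x, R s x))) t
        (hΨ.differentiable one_ne_zero _).hasFDerivAt
        ((hasDerivAt_id t).prodMk (hY.prodMk (hRderiv x t)))
  calc _ = ∫ t in (0 : ℝ)..1, ∫ x, G (t, (Y t x, R t x)) ∂μ₀ :=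
        intervalIntegral.integral_congr fun t ht =>
          hpush t (by rwa [Set.uIcc_of_le zero_le_one] at ht)
    _ = ∫ x, (∫ t in (0 : ℝ)..1, G (t, (Y t x, R t x))) ∂μ₀ := by
        simp only [intervalIntegral.integral_of_le zero_le_one]
        refine integral_integral_swap (Integrable.of_bound ?_ C (ae_of_all _ fun _ => hC _))
        exact (hGcont.measurable.comp
          (measurable_fst.prodMk (hYjoint.prodMk hRjoint))).aestronglyMeasurable
    _ = 0 := integral_eq_zero_of_ae (hKae.mono hinner)

end
end

section
/- Let d ≥ 1, r > 0, a, v, g ∈ ℝ^d, b, β ∈ ℝ, and let M be a d × d real matrix. Define the spatial component W = M a + 2β a + (b/r) v ∈ ℝ^d and the radial component ω = 2r⟨g, a⟩ + 2bβ − r⟨v, a⟩ ∈ ℝ. Then sqrt( r²‖W‖² + ω² ) ≤ ( ‖M‖_op + 2‖g‖ + 2‖v‖ + 4|β| ) · sqrt( r²‖a‖² + b² ), where ‖M‖_op is the operator norm. In particular, the cone covariant derivative of the lifted field V(x,r) = (v(x), 2β(x)r) in a direction U = (a, b), which has exactly the components (W, ω) with M = Dv(x) and g = ∇β(x), has cone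 norm at most ( ‖Dv‖_op + 2‖∇β‖ + 2‖v‖ + 4|β| ) times the cone norm of U. -/
open Real
open scoped RealInnerProductSpace

noncomputable section

/-- The cone norm of the covariant derivative of a lifted field is controlled: with
`W = M a + 2β a + (b/r) v` and `ω = 2r⟨g,a⟩ + 2bβ − r⟨v,a⟩`,
`sqrt(r²‖W‖² + ω²) ≤ (‖M‖ + 2‖g‖ + 2‖v‖ + 4|β|) · sqrt(r²‖a‖² + b²)`. -/
theorem cone_covariant_derivative_bound {d : ℕ} (hd : 1 ≤ d)
    (r : ℝ) (hr : 0 < r)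
    (a v g : EuclideanSpace ℝ (Fin d)) (b β : ℝ)
    (M : EuclideanSpace ℝ (Fin d) →L[ℝ] EuclideanSpace ℝ (Fin d))
    (W : EuclideanSpace ℝ (Fin d))
    (hW : W = M a + (2 * β) • a + (b / r) • v)
    (ω : ℝ)
    (hω : ω = 2 * r * ⟪g, a⟫ + 2 * b * β - r * ⟪v, a⟫) :
    Real.sqrt (r ^ 2 * ‖W‖ ^ 2 + ω ^ 2) ≤
      (‖M‖ + 2 * ‖g‖ + 2 * ‖v‖ + 4 * |β|) * Real.sqrt (r ^ 2 * ‖a‖ ^ 2 + b ^ 2) := by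
  set N := Real.sqrt (r ^ 2 * ‖a‖ ^ 2 + b ^ 2)
  have ha : r * ‖a‖ ≤ N := Real.le_sqrt_of_sq_le (by nlinarith [sq_nonneg b])
  have hb : |b| ≤ N := Real.abs_le_sqrt (by nlinarith [sq_nonneg (r * ‖a‖)])
  have hWle : r * ‖W‖ ≤ (‖M‖ + 2 * |β| + ‖v‖) * N := by
    have h : ‖W‖ ≤ ‖M‖ * ‖a‖ + 2 * |β| * ‖a‖ + |b| / r * ‖v‖ := by
      rw [hW]
      refine (norm_add₃_le).trans ?_
      rw [norm_smul, norm_smul, Real.norm_eq_abs, Real.norm_eq_abs, abs_mul, abs_div,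
        abs_of_pos hr, abs_two]
      gcongr
      exact M.le_opNorm a
    calc r * ‖W‖ ≤ r * (‖M‖ * ‖a‖ + 2 * |β| * ‖a‖ + |b| / r * ‖v‖) := by gcongr
      _ = (‖M‖ + 2 * |β|) * (r * ‖a‖) + ‖v‖ * |b| := by field_simp
      _ ≤ (‖M‖ + 2 * |β|) * N + ‖v‖ * N := by gcongr
      _ = (‖M‖ + 2 * |β| + ‖v‖) * N := by ring
  have hωle : |ω| ≤ (2 * ‖g‖ + 2 * |β| + ‖v‖) * N := by
    calc |ω| ≤ |2 * r * ⟪g, a⟫| + |2 * b * β| + |r * ⟪v, a⟫| := by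
          rw [hω]
          exact (abs_sub _ _).trans (by gcongr; exact abs_add_le _ _)
      _ = 2 * r * |⟪g, a⟫| + 2 * |b| * |β| + r * |⟪v, a⟫| := by
          simp only [abs_mul, abs_two, abs_of_pos hr]
      _ ≤ 2 * r * (‖g‖ * ‖a‖) + 2 * |b| * |β| + r * (‖v‖ * ‖a‖) := by
          gcongr <;> exact abs_real_inner_le_norm _ _
      _ = (2 * ‖g‖ + ‖v‖) * (r * ‖a‖) + 2 * |β| * |b| := by ring
      _ ≤ (2 * ‖g‖ + ‖v‖) * N + 2 * |β| * N := by gcongr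
      _ = (2 * ‖g‖ + 2 * |β| + ‖v‖) * N := by ring
  calc Real.sqrt (r ^ 2 * ‖W‖ ^ 2 + ω ^ 2) ≤ r * ‖W‖ + |ω| := by
        refine Real.sqrt_le_iff.mpr ⟨by positivity, ?_⟩
        have h : 0 ≤ r * ‖W‖ * |ω| := by positivity
        nlinarith [sq_abs ω]
    _ ≤ (‖M‖ + 2 * |β| + ‖v‖) * N + (2 * ‖g‖ + 2 * |β| + ‖v‖) * N := add_le_add hWle hωle
    _ = (‖M‖ + 2 * ‖g‖ + 2 * ‖v‖ + 4 * |β|) * N := by ring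

end
end

section
/- For C¹ cone vector fields F(x,r) = (A(x,r), B(x,r)) on ℝ^d × (0,∞) and tangent directions (a,b) ∈ ℝ^d × ℝ at (x,r) with r > 0, define the coordinate expression of the Levi-Civita covariant derivative of the cone metric dr² + r²⟨·,·⟩: ∇^C_{(a,b)}F = ( D_xA·a + b ∂_rA + (b/r) A + (B/r) a, ⟨∇_xB, a⟩ + b ∂_rB − r⟨a, A⟩ ). Then for φ ∈ C¹(ℝ^d) and ψ ∈ C²(ℝ^d), the lifted gradient fields U(x,r) = (∇φ(x), 2rφ(x)) and W(x,r) = (∇ψ(x), 2rψ(x)) satisfy, at every (x,r) with r > 0: ∇^C_{U(x,r)}W = ( Hψ(x)∇φ(x) + 2φ(x)∇ψ(x) + 2ψ(x)∇φ(x), 2r( ½⟨∇ψ(x), ∇φ(x)⟩ + 2φ(x)ψ(x) ) ), where Hψ denotes the Hessian matrix of ψ. In other words, the cone covariant derivative of the lift of an HK potential field along the lift of another HK potential field equals the lift of the Hellinger–Kantorovich total-derivative expression. -/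
open Real
open scoped RealInnerProductSpace

noncomputable section

/-- Coordinate expression of the Levi-Civita covariant derivative of the cone metric
`dr² + r²⟨·,·⟩` applied to a cone vector field `F = (A, B)` in the direction `(a, b)` at the
point `p = (x, r)`:
`∇^C_{(a,b)}F = (D_xA·a + b ∂_rA + (b/r) A + (B/r) a, ⟨∇_xB, a⟩ + b ∂_rB − r⟨a, A⟩)`. -/
def coneCovDeriv {d : ℕ}
    (F : EuclideanSpace ℝ (Fin d) × ℝ → EuclideanSpace ℝ (Fin d) × ℝ)
    (p : EuclideanSpace ℝ (Fin d) × ℝ) (ab : EuclideanSpace ℝ (Fin d) × ℝ) :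
    EuclideanSpace ℝ (Fin d) × ℝ :=
  (fderiv ℝ (fun y => (F (y, p.2)).1) p.1 ab.1
      + ab.2 • deriv (fun ρ => (F (p.1, ρ)).1) p.2
      + (ab.2 / p.2) • (F p).1
      + ((F p).2 / p.2) • ab.1,
    ⟪gradient (fun y => (F (y, p.2)).2) p.1, ab.1⟫
      + ab.2 * deriv (fun ρ => (F (p.1, ρ)).2) p.2
      - p.2 * ⟪ab.1, (F p).1⟫)

/-- The cone covariant derivative of the lift `W(x,r) = (∇ψ(x), 2rψ(x))` of an HK potential
field along the lift `U(x,r) = (∇φ(x), 2rφ(x))` of another equals the lift of the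
Hellinger–Kantorovich total-derivative expression:
`∇^C_{U}W = (Hψ·∇φ + 2φ∇ψ + 2ψ∇φ, 2r(½⟨∇ψ,∇φ⟩ + 2φψ))`. -/
theorem cone_cov_deriv_of_lifted_potentials {d : ℕ}
    (φ ψ : EuclideanSpace ℝ (Fin d) → ℝ)
    (hφ : ContDiff ℝ 1 φ) (hψ : ContDiff ℝ 2 ψ)
    (U W : EuclideanSpace ℝ (Fin d) × ℝ → EuclideanSpace ℝ (Fin d) × ℝ)
    (hU : ∀ p, U p = (gradient φ p.1, 2 * p.2 * φ p.1))
    (hW : ∀ p, W p = (gradient ψ p.1, 2 * p.2 * ψ p.1)) :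
    ∀ (x : EuclideanSpace ℝ (Fin d)) (r : ℝ), 0 < r →
      coneCovDeriv W (x, r) (U (x, r)) =
        (fderiv ℝ (fun y => gradient ψ y) x (gradient φ x)
            + (2 * φ x) • gradient ψ x + (2 * ψ x) • gradient φ x,
          2 * r * ((1 / 2) * ⟪gradient ψ x, gradient φ x⟫ + 2 * φ x * ψ x)) := by
  intro x r hr
  have hgrad : gradient (fun y => 2 * r * ψ y) x = (2 * r) • gradient ψ x := by
    have h : DifferentiableAt ℝ ψ x := hψ.differentiable (by norm_num) x
    simp only [gradient, fderiv_const_mul h, map_smul]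
  have hderiv : deriv (fun ρ : ℝ => 2 * ρ * ψ x) r = 2 * ψ x := by
    simp
  have hφr : 2 * r * φ x / r = 2 * φ x := by field_simp
  have hψr : 2 * r * ψ x / r = 2 * ψ x := by field_simp
  simp only [coneCovDeriv, hU, hW, hgrad, hderiv, hφr, hψr, deriv_const, smul_zero, add_zero,
    real_inner_smul_left, real_inner_comm (gradient ψ x) (gradient φ x), Prod.mk.injEq, true_and]
  ring

end
end
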